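/- arXiv:1304.1606 — 3 statements merged into one kernel-verified Lean document; each statement's English description precedes it below -/
import Mathlib

section
/- For complex ν with Re ν > -1: ∫_{-1}^1 x [P_{ν+1}(x)]³ (1-x²)^{(ν-1)/2} dx = (3/8) ∫_{-1}^1 [P_ν(x)]³ (1-x²)^{(ν-1)/2} dx. -/
open Real MeasureTheory intervalIntegral Complex

/-- Complete elliptic integral of the first kind. -/
noncomputable def ellipticK (k : ℝ) : ℝ :=
  ∫ θ in (0:ℝ)..(π/2), (1 - k ^ 2 * Real.sin θ ^ 2) ^ (-(1/2 : ℝ))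

/-- Complete elliptic integral of the second kind. -/
noncomputable def ellipticE (k : ℝ) : ℝ :=
  ∫ θ in (0:ℝ)..(π/2), (1 - k ^ 2 * Real.sin θ ^ 2) ^ ((1/2 : ℝ))

/-- Legendre function of the first kind of degree ν : P_ν(1-2z) = ₂F₁(-ν, ν+1; 1; z). -/
noncomputable def legendreP (ν : ℂ) (x : ℂ) : ℂ :=
  ordinaryHypergeometric (-ν) (ν + 1) 1 ((1 - x) / 2)

noncomputable def lgA (ν : ℂ) (k : ℕ) : ℂ :=
  (ascPochhammer ℂ k).eval (-ν) * (ascPochhammer ℂ k).eval (ν + 1) / (k.factorial : ℂ) ^ 2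

noncomputable def lgB (ε : ℝ) (k : ℕ) : ℝ := (ascPochhammer ℝ k).eval ε / (k.factorial : ℝ)

lemma lgP_eq (ν x : ℂ) : legendreP ν x = ∑' k, lgA ν k * ((1 - x) / 2) ^ k := by
  unfold legendreP
  rw [ordinaryHypergeometric_eq_tsum]
  refine tsum_congr fun k => ?_
  rw [ascPochhammer_eval_one, smul_eq_mul, lgA]
  field_simp

lemma lgA_succ (ν : ℂ) (k : ℕ) :
    lgA ν (k + 1) = lgA ν k * (((k : ℂ) - ν) * (k + 1 + ν) / ((k : ℂ) + 1) ^ 2) := by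
  have h : ((k : ℂ) + 1) ≠ 0 := by exact_mod_cast k.succ_ne_zero
  have h2 : ((k.factorial : ℂ)) ≠ 0 := by exact_mod_cast k.factorial_ne_zero
  simp only [lgA, ascPochhammer_succ_eval, Nat.factorial_succ]
  push_cast
  field_simp
  ring

lemma lgB_succ (ε : ℝ) (k : ℕ) : lgB ε (k + 1) = lgB ε k * (((k : ℝ) + ε) / (k + 1)) := by
  have h : ((k : ℝ) + 1) ≠ 0 := by exact_mod_cast k.succ_ne_zero
  have h2 : ((k.factorial : ℝ)) ≠ 0 := by exact_mod_cast k.factorial_ne_zero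
  simp only [lgB, ascPochhammer_succ_eval, Nat.factorial_succ]
  push_cast
  field_simp
  ring

lemma lgB_pos {ε : ℝ} (h : 0 < ε) (k : ℕ) : 0 < lgB ε k := by
  induction k with
  | zero => simp [lgB]
  | succ k ih => rw [lgB_succ]; positivity

lemma lgB_le {ε : ℝ} (h : 0 < ε) (h1 : ε ≤ 1) (k : ℕ) : lgB ε k ≤ 1 := by
  induction k with
  | zero => simp [lgB]
  | succ k ih =>
    rw [lgB_succ]
    have : ((k : ℝ) + ε) / (k + 1) ≤ 1 := by
      rw [div_le_one (by positivity)]; linarith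
    exact mul_le_one₀ ih (by positivity) this

lemma lgB_aux (ε z : ℝ) (k : ℕ) : lgB ε k * z ^ k =
    Ring.choose (-ε) k • (List.ofFn fun _ : Fin k => -z).prod := by
  simp only [List.ofFn_const, List.prod_replicate, smul_eq_mul, Ring.choose_eq_smul,
    Polynomial.descPochhammer_smeval_eq_ascPochhammer,
    Polynomial.ascPochhammer_smeval_cast, Polynomial.ascPochhammer_smeval_eq_eval]
  have e : (ascPochhammer ℝ k).eval (-ε - k + 1) = (-1)^k * (ascPochhammer ℝ k).eval ε := by
    rw [← descPochhammer_eval_eq_ascPochhammer]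
    have h1 := ascPochhammer_eval_neg_eq_descPochhammer ℝ (-ε) k
    rw [neg_neg] at h1
    rw [h1, ← mul_assoc, ← mul_pow]; simp
  rw [e, lgB]
  have : (-1 : ℝ) ^ k * (-1) ^ k = 1 := by rw [← mul_pow]; simp
  rw [neg_pow z]
  linear_combination (-(ascPochhammer ℝ k).eval ε / k.factorial * z ^ k) * this

lemma lgB_hasSum (ε : ℝ) {z : ℝ} (h0 : 0 ≤ z) (h1 : z < 1) :
    HasSum (fun k => lgB ε k * z ^ k) ((1 - z) ^ (-ε)) := by
  have := (Real.one_add_rpow_hasFPowerSeriesOnBall_zero (a := -ε)).hasSum (y := -z)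
    (by simp [abs_of_nonneg h0, enorm_eq_nnnorm, ← NNReal.coe_lt_coe, h1])
  simp only [zero_add, binomialSeries_apply] at this
  rw [← sub_eq_add_neg] at this
  have e0 : (fun k => lgB ε k * z ^ k) =
      fun n => Ring.choose (-ε) n • (List.ofFn fun _ : Fin n => -z).prod := by
    funext k
    exact lgB_aux ε z k
  rw [e0]
  exact this

lemma lgA_bound (ν : ℂ) {ε : ℝ} (h : 0 < ε) : ∃ C, 0 ≤ C ∧ ∀ k, ‖lgA ν k‖ ≤ C * lgB ε k := by
  obtain ⟨K, hK⟩ := exists_nat_ge (‖ν * (ν + 1)‖ / ε)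
  rw [div_le_iff₀ h] at hK
  refine ⟨∑ j ∈ Finset.range (K + 1), ‖lgA ν j‖ / lgB ε j,
    Finset.sum_nonneg fun j _ => div_nonneg (norm_nonneg _) (lgB_pos h j).le, fun k => ?_⟩
  have base : ∀ k ≤ K, ‖lgA ν k‖ ≤
      (∑ j ∈ Finset.range (K + 1), ‖lgA ν j‖ / lgB ε j) * lgB ε k := by
    intro k hk
    rw [← div_le_iff₀ (lgB_pos h k)]
    exact Finset.single_le_sum (f := fun j => ‖lgA ν j‖ / lgB ε j)
      (fun j _ => div_nonneg (norm_nonneg _) (lgB_pos h j).le) (by simp; omega)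
  generalize (∑ j ∈ Finset.range (K + 1), ‖lgA ν j‖ / lgB ε j) = C at base
  induction k with
  | zero => exact base 0 (by omega)
  | succ k ih =>
    by_cases hk : k + 1 ≤ K
    · exact base _ hk
    · have hk' : (K : ℝ) ≤ k := by exact_mod_cast (by omega : K ≤ k)
      rw [lgA_succ, lgB_succ, norm_mul, ← mul_assoc]
      refine mul_le_mul ih ?_ (norm_nonneg _) ((norm_nonneg _).trans ih)
      have hn : ‖((k : ℂ) + 1) ^ 2‖ = ((k : ℝ) + 1) ^ 2 := by
        rw [norm_pow]; congr 1
        exact_mod_cast Complex.norm_natCast (k + 1)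
      rw [norm_div, hn, div_le_div_iff₀ (by positivity) (by positivity)]
      have e : ((k : ℂ) - ν) * (k + 1 + ν) = ((k * (k + 1) : ℕ) : ℂ) - ν * (ν + 1) := by
        push_cast; ring
      have : ‖((k : ℂ) - ν) * (k + 1 + ν)‖ ≤ k * (k + 1) + ‖ν * (ν + 1)‖ := by
        rw [e]
        refine (norm_sub_le _ _).trans ?_
        rw [Complex.norm_natCast]; push_cast; rfl
      have h3 : ‖((k : ℂ) - ν) * (k + 1 + ν)‖ ≤ (k + ε) * (k + 1) := by nlinarith
      nlinarith [mul_le_mul_of_nonneg_right h3 (by positivity : (0:ℝ) ≤ k + 1)]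

lemma lgP_bound (ν : ℂ) {ε : ℝ} (h : 0 < ε) : ∃ C, 0 ≤ C ∧ ∀ x : ℝ, x ∈ Set.Ioo (-1:ℝ) 1 →
    ‖legendreP ν x‖ ≤ C * (1 - x ^ 2) ^ (-ε) := by
  obtain ⟨C, hC, hb⟩ := lgA_bound ν h
  refine ⟨C * 4 ^ ε, by positivity, fun x hx => ?_⟩
  obtain ⟨hx1, hx2⟩ := hx
  have hs := (lgB_hasSum ε (z := (1 - x) / 2) (by linarith) (by linarith)).mul_left C
  rw [lgP_eq]
  have key : ‖∑' k, lgA ν k * ((1 - (x:ℂ)) / 2) ^ k‖ ≤ C * (1 - (1 - x) / 2) ^ (-ε) := by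
    refine tsum_of_norm_bounded hs fun k => ?_
    have : ((1 - (x:ℂ)) / 2) = (((1 - x) / 2 : ℝ) : ℂ) := by push_cast; rfl
    rw [norm_mul, norm_pow, this, Complex.norm_real, Real.norm_of_nonneg (by linarith), ← mul_assoc]
    exact mul_le_mul_of_nonneg_right (hb k) (pow_nonneg (by linarith) _)
  refine key.trans ?_
  rw [mul_assoc]
  refine mul_le_mul_of_nonneg_left ?_ hC
  have h4 : (4:ℝ) ^ ε = (4⁻¹ : ℝ) ^ (-ε) := by
    rw [Real.rpow_neg (by norm_num), Real.inv_rpow (by norm_num), inv_inv]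
  rw [h4, ← Real.mul_rpow (by norm_num) (by nlinarith)]
  exact Real.rpow_le_rpow_of_nonpos (by nlinarith) (by nlinarith) (by linarith)

lemma lg_ser {a : ℕ → ℂ} {C : ℝ} (ha : ∀ k, ‖a k‖ ≤ C) {z : ℂ} (hz : ‖z‖ < 1) :
    Summable (fun k => a k * z ^ k) ∧ Summable (fun k : ℕ => (k : ℂ) * a k * z ^ k) ∧
    ∃ D, HasDerivAt (fun w => ∑' k, a k * w ^ k) D z ∧
      z * D = ∑' k : ℕ, (k : ℂ) * a k * z ^ k := by
  have hC : 0 ≤ C := (norm_nonneg _).trans (ha 0)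
  obtain ⟨r, hr1, hr2⟩ := exists_between hz
  have hr0 : 0 < r := (norm_nonneg z).trans_lt hr1
  have s1 : ∀ w : ℂ, ‖w‖ < 1 → Summable (fun k => a k * w ^ k) := by
    intro w hw
    refine Summable.of_norm_bounded (g := fun k => C * ‖w‖ ^ k)
      ((summable_geometric_of_lt_one (norm_nonneg _) hw).mul_left C) fun k => ?_
    rw [norm_mul, norm_pow]
    exact mul_le_mul_of_nonneg_right (ha k) (by positivity)
  have s2 : ∀ r : ℝ, 0 ≤ r → r < 1 → Summable (fun k : ℕ => (k : ℝ) * r ^ k) := by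
    intro r h0 h1
    have := summable_pow_mul_geometric_of_norm_lt_one 1 (r := r) (by rwa [Real.norm_of_nonneg h0])
    simpa using this
  refine ⟨s1 z hz, ?_, ?_⟩
  · refine Summable.of_norm_bounded (g := fun k => C * (k * ‖z‖ ^ k))
      ((s2 _ (norm_nonneg _) hz).mul_left C) fun k => ?_
    rw [norm_mul, norm_mul, norm_pow, Complex.norm_natCast]
    have := mul_le_mul_of_nonneg_right (ha k) (by positivity : 0 ≤ (k:ℝ) * ‖z‖ ^ k)
    linarith
  · refine ⟨∑' k : ℕ, a k * (k * z ^ (k - 1)), ?_, ?_⟩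
    · have su : Summable (fun k : ℕ => C * r⁻¹ * (k * r ^ k)) :=
        (s2 r hr0.le hr2).mul_left _
      refine hasDerivAt_tsum_of_isPreconnected (t := Metric.ball (0:ℂ) r) su Metric.isOpen_ball
        (convex_ball _ _).isPreconnected (g := fun k w => a k * w ^ k)
        (g' := fun k w => a k * (k * w ^ (k - 1)))
        (fun k y _ => (hasDerivAt_pow k y).const_mul _) ?_ (y₀ := 0) (by simpa using hr0)
        (s1 0 (by simp)) (by simpa using hr1)
      intro k y hy
      have hy' : ‖y‖ ≤ r := by simpa using (Metric.mem_ball.1 hy).le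
      rw [norm_mul, norm_mul, norm_pow, Complex.norm_natCast]
      rcases k with _ | k
      · simp
      · have e : C * r⁻¹ * (((k + 1 : ℕ) : ℝ) * r ^ (k + 1)) = C * (((k + 1 : ℕ) : ℝ) * r ^ k) := by
          field_simp
          ring
        rw [e, Nat.add_sub_cancel]
        have := ha (k + 1)
        gcongr
    · rw [← tsum_mul_left]
      refine tsum_congr fun k => ?_
      rcases k with _ | k
      · simp
      · rw [Nat.add_sub_cancel]; ring

lemma lg_shift {u v : ℕ → ℂ} {z U V : ℂ} (hu : HasSum (fun k => u k * z ^ k) U)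
    (hv : HasSum (fun k => v k * z ^ k) V) (h0 : u 0 = 0) (h : ∀ k, u (k + 1) = - v k) :
    U + z * V = 0 := by
  have h1 := (hasSum_nat_add_iff' 1).2 hu
  simp only [Finset.sum_range_one, h0, zero_mul, sub_zero, h] at h1
  have h2 := hv.mul_left (-z)
  have h3 : (fun k => - v k * z ^ (k + 1)) = fun k => -z * (v k * z ^ k) := by
    funext k; ring
  rw [h3] at h1
  rw [h1.unique h2]; ring

lemma poch_shift (n : ℂ) (m : ℕ) :
    n * (ascPochhammer ℂ m).eval (n + 1) = (ascPochhammer ℂ m).eval n * (n + m) := by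
  rw [← ascPochhammer_succ_eval, ascPochhammer_succ_left]
  simp

lemma lg_relA (ν : ℂ) (m : ℕ) : lgA (ν + 1) (m + 1) =
    - lgA ν m * ((ν + 1 + m) * (ν + 1 + m + 1)) / ((m : ℂ) + 1) ^ 2 := by
  have h : ((m : ℂ) + 1) ≠ 0 := by exact_mod_cast m.succ_ne_zero
  have h2 : ((m.factorial : ℂ)) ≠ 0 := by exact_mod_cast m.factorial_ne_zero
  have e1 := poch_shift (ν + 1) m
  have e2 := poch_shift (-(ν + 1)) m
  rw [show -(ν + 1) + 1 = -ν by ring] at e2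
  rw [lgA, lgA, ascPochhammer_succ_eval, ascPochhammer_succ_eval, ← e2, Nat.factorial_succ]
  push_cast
  field_simp
  linear_combination (-(ascPochhammer ℂ m).eval (-ν) * (ν + 1 + 1 + m)) * e1

lemma lg_relB (ν : ℂ) (m : ℕ) : lgA ν (m + 1) =
    - lgA (ν + 1) m * ((m - (ν + 1)) * (m + 1 - (ν + 1))) / ((m : ℂ) + 1) ^ 2 := by
  have h : ((m : ℂ) + 1) ≠ 0 := by exact_mod_cast m.succ_ne_zero
  have h2 : ((m.factorial : ℂ)) ≠ 0 := by exact_mod_cast m.factorial_ne_zero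
  have e1 := poch_shift (ν + 1) m
  have e2 := poch_shift (-(ν + 1)) m
  rw [show -(ν + 1) + 1 = -ν by ring] at e2
  rw [lgA, lgA, ascPochhammer_succ_eval, ascPochhammer_succ_eval, ← e1, Nat.factorial_succ]
  push_cast
  field_simp
  linear_combination (-(ascPochhammer ℂ m).eval (ν + 1 + 1) * (-ν + m)) * e2

lemma lg_main (ν : ℂ) {x : ℝ} (hx : x ∈ Set.Ioo (-1:ℝ) 1) :
    ∃ p' q', HasDerivAt (fun y : ℝ => legendreP ν y) p' x ∧
      HasDerivAt (fun y : ℝ => legendreP (ν + 1) y) q' x ∧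
      (1 - (x:ℂ) ^ 2) * p' = (ν + 1) * (x * legendreP ν x - legendreP (ν + 1) x) ∧
      (1 - (x:ℂ) ^ 2) * q' = (ν + 1) * (legendreP ν x - x * legendreP (ν + 1) x) := by
  have bd : ∀ μ : ℂ, ∃ C, ∀ k, ‖lgA μ k‖ ≤ C := by
    intro μ
    obtain ⟨C, hC, h⟩ := lgA_bound μ one_pos
    exact ⟨C, fun k => (h k).trans (mul_le_of_le_one_right hC (lgB_le one_pos le_rfl k))⟩
  obtain ⟨C1, h1⟩ := bd ν
  obtain ⟨C2, h2⟩ := bd (ν + 1)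
  set z : ℂ := (1 - (x:ℂ)) / 2 with hzd
  have hz : ‖z‖ < 1 := by
    have : z = (((1 - x) / 2 : ℝ) : ℂ) := by rw [hzd]; push_cast; rfl
    rw [this, Complex.norm_real, Real.norm_of_nonneg (by linarith [hx.2])]
    linarith [hx.1]
  obtain ⟨sp0, sp1, Dp, hDp, ep⟩ := lg_ser h1 hz
  obtain ⟨sq0, sq1, Dq, hDq, eq⟩ := lg_ser h2 hz
  have dz : HasDerivAt (fun y : ℂ => (1 - y) / 2) (-1 / 2) (x : ℂ) :=
    ((hasDerivAt_id (x:ℂ)).const_sub 1).div_const 2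
  have Hd : ∀ (μ D : ℂ), HasDerivAt (fun w => ∑' k, lgA μ k * w ^ k) D z →
      HasDerivAt (fun y : ℝ => legendreP μ y) (D * (-1 / 2)) x := by
    intro μ D h
    have h3 : HasDerivAt (fun y : ℂ => legendreP μ y) (D * (-1 / 2)) (x : ℂ) := by
      have h4 := HasDerivAt.comp (x : ℂ) (h₂ := fun w => ∑' k, lgA μ k * w ^ k)
        (h := fun y : ℂ => (1 - y) / 2) h dz
      have h5 : (fun y : ℂ => legendreP μ y) =
          (fun w => ∑' k, lgA μ k * w ^ k) ∘ fun y : ℂ => (1 - y) / 2 := by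
        funext y; exact lgP_eq μ y
      rw [h5]; exact h4
    exact h3.comp_ofReal
  refine ⟨_, _, Hd _ _ hDp, Hd _ _ hDq, ?_, ?_⟩
  · have key := lg_shift (z := z)
      (u := fun k => -2 * (k * lgA ν k) - (ν + 1) * lgA ν k + (ν + 1) * lgA (ν + 1) k)
      (v := fun k => 2 * (k * lgA ν k) + 2 * (ν + 1) * lgA ν k)
      (U := -2 * (z * Dp) - (ν + 1) * legendreP ν x + (ν + 1) * legendreP (ν + 1) x)
      (V := 2 * (z * Dp) + 2 * (ν + 1) * legendreP ν x) ?_ ?_ ?_ ?_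
    · have hx' : (x : ℂ) = 1 - 2 * z := by rw [hzd]; ring
      rw [hx'] at key ⊢
      linear_combination key
    · rw [lgP_eq, lgP_eq, ← hzd, ep]
      have := ((sp1.hasSum.mul_left (-2)).sub (sp0.hasSum.mul_left (ν + 1))).add
        (sq0.hasSum.mul_left (ν + 1))
      refine this.congr_fun ?_
      intro k; ring
    · rw [lgP_eq, ← hzd, ep]
      have := ((sp1.hasSum.mul_left 2).add (sp0.hasSum.mul_left (2 * (ν + 1))))
      refine this.congr_fun ?_
      intro k; ring
    · simp [lgA]
    · intro k
      have h : ((k : ℂ) + 1) ≠ 0 := by exact_mod_cast k.succ_ne_zero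
      simp only [lg_relA ν, lgA_succ ν]
      push_cast
      field_simp
      ring
  · have key := lg_shift (z := z)
      (u := fun k => -2 * (k * lgA (ν + 1) k) + (ν + 1) * lgA (ν + 1) k - (ν + 1) * lgA ν k)
      (v := fun k => 2 * (k * lgA (ν + 1) k) - 2 * (ν + 1) * lgA (ν + 1) k)
      (U := -2 * (z * Dq) + (ν + 1) * legendreP (ν + 1) x - (ν + 1) * legendreP ν x)
      (V := 2 * (z * Dq) - 2 * (ν + 1) * legendreP (ν + 1) x) ?_ ?_ ?_ ?_
    · have hx' : (x : ℂ) = 1 - 2 * z := by rw [hzd]; ring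
      rw [hx'] at key ⊢
      linear_combination key
    · rw [lgP_eq, lgP_eq, ← hzd, eq]
      have := ((sq1.hasSum.mul_left (-2)).add (sq0.hasSum.mul_left (ν + 1))).sub
        (sp0.hasSum.mul_left (ν + 1))
      refine this.congr_fun ?_
      intro k; ring
    · rw [lgP_eq, ← hzd, eq]
      have := ((sq1.hasSum.mul_left 2).sub (sq0.hasSum.mul_left (2 * (ν + 1))))
      refine this.congr_fun ?_
      intro k; ring
    · simp [lgA]
    · intro k
      have h : ((k : ℂ) + 1) ≠ 0 := by exact_mod_cast k.succ_ne_zero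
      simp only [lg_relB ν, lgA_succ (ν + 1)]
      push_cast
      field_simp
      ring

lemma lg_integrable {h : ℝ → ℂ} {C δ : ℝ} (hδ : 0 < δ) (hδ1 : δ ≤ 1) (hC : 0 ≤ C)
    (hc : ContinuousOn h (Set.Ioo (-1:ℝ) 1))
    (hb : ∀ x ∈ Set.Ioo (-1:ℝ) 1, ‖h x‖ ≤ C * (1 - x ^ 2) ^ (δ - 1)) :
    IntervalIntegrable h volume (-1) 1 := by
  have i1 : IntervalIntegrable (fun x : ℝ => (1 + x) ^ (δ - 1)) volume (-1) 1 := by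
    have := (intervalIntegrable_rpow' (a := 0) (b := 2) (r := δ - 1) (by linarith)).comp_add_left 1
    norm_num at this
    exact this
  have i2 : IntervalIntegrable (fun x : ℝ => (1 - x) ^ (δ - 1)) volume (-1) 1 := by
    have := (intervalIntegrable_rpow' (a := 0) (b := 2) (r := δ - 1) (by linarith)).comp_sub_left 1
    norm_num at this
    exact this.symm
  have i3 := (i1.add i2).const_mul C
  rw [intervalIntegrable_iff_integrableOn_Ioo_of_le (by norm_num)] at i3 ⊢
  refine Integrable.mono' i3 (hc.aestronglyMeasurable measurableSet_Ioo) ?_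
  refine (ae_restrict_iff' measurableSet_Ioo).2 (Filter.Eventually.of_forall fun x hx => ?_)
  refine (hb x hx).trans ?_
  refine mul_le_mul_of_nonneg_left ?_ hC
  obtain ⟨h1, h2⟩ := hx
  have p1 : 0 ≤ (1 + x) ^ (δ - 1) := Real.rpow_nonneg (by linarith) _
  have p2 : 0 ≤ (1 - x) ^ (δ - 1) := Real.rpow_nonneg (by linarith) _
  change _ ≤ (1 + x) ^ (δ - 1) + (1 - x) ^ (δ - 1)
  rcases le_total 0 x with h0 | h0
  · have : (1 - x ^ 2) ^ (δ - 1) ≤ (1 - x) ^ (δ - 1) :=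
      Real.rpow_le_rpow_of_nonpos (by linarith) (by nlinarith) (by linarith)
    linarith
  · have : (1 - x ^ 2) ^ (δ - 1) ≤ (1 + x) ^ (δ - 1) :=
      Real.rpow_le_rpow_of_nonpos (by linarith) (by nlinarith) (by linarith)
    linarith

theorem stmt8 (ν : ℂ) (hν : -1 < ν.re) :
    (∫ x in (-1:ℝ)..1, (x : ℂ) * (legendreP (ν + 1) (x : ℂ)) ^ 3 *
        ((1 - (x:ℂ) ^ 2) ^ ((ν - 1)/2)))
      = (3/8) * ∫ x in (-1:ℝ)..1, (legendreP ν (x : ℂ)) ^ 3 *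
          ((1 - (x:ℂ) ^ 2) ^ ((ν - 1)/2)) := by
  have hn : ν + 1 ≠ 0 := by
    intro h
    have := congrArg Complex.re h
    simp at this
    linarith
  set δ : ℝ := min (ν.re + 1) 1 / 4 with hδd
  have hδ : 0 < δ := by
    have : 0 < min (ν.re + 1) 1 := lt_min (by linarith) one_pos
    positivity
  have hδ1 : δ ≤ 1 := by linarith [min_le_right (ν.re + 1) 1]
  have hδ2 : 4 * δ ≤ ν.re + 1 := by linarith [min_le_left (ν.re + 1) 1]
  clear_value δ
  have hy0 : ∀ x ∈ Set.Ioo (-1:ℝ) 1, 0 < 1 - x ^ 2 := fun x hx => by nlinarith [hx.1, hx.2]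
  have hy1 : ∀ x : ℝ, 1 - x ^ 2 ≤ 1 := fun x => by nlinarith
  have hcast : ∀ x : ℝ, (1 - (x:ℂ) ^ 2) = ((1 - x ^ 2 : ℝ) : ℂ) := fun x => by push_cast; rfl
  have hW : ∀ (s : ℂ) (t : ℝ), t ≤ s.re → ∀ x ∈ Set.Ioo (-1:ℝ) 1,
      ‖(1 - (x:ℂ) ^ 2) ^ s‖ ≤ (1 - x ^ 2) ^ t := by
    intro s t hs x hx
    rw [hcast, Complex.norm_cpow_eq_rpow_re_of_pos (hy0 x hx)]
    exact Real.rpow_le_rpow_of_exponent_ge (hy0 x hx) (hy1 x) hs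
  obtain ⟨Cp, hCp, bp⟩ := lgP_bound ν (ε := δ / 3) (by positivity)
  obtain ⟨Cq, hCq, bq⟩ := lgP_bound (ν + 1) (ε := δ / 3) (by positivity)
  have y3 : ∀ x ∈ Set.Ioo (-1:ℝ) 1, ((1 - x ^ 2) ^ (-(δ / 3))) ^ 3 = (1 - x ^ 2) ^ (-δ) := by
    intro x hx
    rw [← Real.rpow_natCast, ← Real.rpow_mul (hy0 x hx).le]
    congr 1; push_cast; ring
  have hs1 : 2 * δ - 1 ≤ ((ν - 1) / 2).re := by
    simp; linarith
  have hs2 : 2 * δ ≤ ((ν + 1) / 2).re := by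
    simp; linarith
  have yadd : ∀ x ∈ Set.Ioo (-1:ℝ) 1, ∀ t : ℝ,
      (1 - x ^ 2) ^ (-δ) * (1 - x ^ 2) ^ (t + δ) = (1 - x ^ 2) ^ t := by
    intro x hx t
    rw [← Real.rpow_add (hy0 x hx)]
    congr 1; ring
  have dP : ∀ x ∈ Set.Ioo (-1:ℝ) 1, _ := fun x hx => lg_main ν (x := x) hx
  have cP : ContinuousOn (fun x : ℝ => legendreP ν x) (Set.Ioo (-1:ℝ) 1) := by
    intro x hx
    obtain ⟨p', q', h1, h2, -, -⟩ := dP x hx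
    exact h1.continuousAt.continuousWithinAt
  have cQ : ContinuousOn (fun x : ℝ => legendreP (ν + 1) x) (Set.Ioo (-1:ℝ) 1) := by
    intro x hx
    obtain ⟨p', q', h1, h2, -, -⟩ := dP x hx
    exact h2.continuousAt.continuousWithinAt
  have dW : ∀ s : ℂ, ∀ x ∈ Set.Ioo (-1:ℝ) 1, HasDerivAt (fun y : ℝ => (1 - (y:ℂ) ^ 2) ^ s)
      (s * (1 - (x:ℂ) ^ 2) ^ (s - 1) * (-(2 * x))) x := by
    intro s x hx
    have h1 : HasDerivAt (fun y : ℂ => 1 - y ^ 2) (-(2 * (x : ℂ))) (x : ℂ) := by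
      simpa using (hasDerivAt_pow 2 (x : ℂ)).const_sub 1
    have h2 := HasDerivAt.cpow_const (c := s) h1 (by
      rw [hcast]; exact Complex.ofReal_mem_slitPlane.2 (hy0 x hx))
    exact h2.comp_ofReal
  have cW : ∀ s : ℂ, ContinuousOn (fun y : ℝ => (1 - (y:ℂ) ^ 2) ^ s) (Set.Ioo (-1:ℝ) 1) :=
    fun s x hx => (dW s x hx).continuousAt.continuousWithinAt
  have If : IntervalIntegrable (fun x : ℝ => (x : ℂ) * (legendreP (ν + 1) (x : ℂ)) ^ 3 *
        ((1 - (x:ℂ) ^ 2) ^ ((ν - 1)/2))) volume (-1) 1 := by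
    refine lg_integrable (C := Cq ^ 3) hδ hδ1 (by positivity)
      ((Complex.continuous_ofReal.continuousOn.mul (cQ.pow 3)).mul (cW _)) fun x hx => ?_
    have hx1 : ‖(x:ℂ)‖ ≤ 1 := by
      rw [Complex.norm_real]; exact abs_le.2 ⟨hx.1.le, hx.2.le⟩
    rw [norm_mul, norm_mul, norm_pow]
    have h3 : ‖legendreP (ν + 1) x‖ ^ 3 ≤ Cq ^ 3 * (1 - x ^ 2) ^ (-δ) := by
      rw [← y3 x hx, ← mul_pow]
      exact pow_le_pow_left₀ (norm_nonneg _) (bq x hx) 3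
    calc _ ≤ 1 * (Cq ^ 3 * (1 - x ^ 2) ^ (-δ)) * (1 - x ^ 2) ^ (2 * δ - 1) := by
          have h4 := hW _ _ hs1 x hx
          have h5 : 0 ≤ (1 - x ^ 2) ^ (-δ) := Real.rpow_nonneg (hy0 x hx).le _
          gcongr
      _ = _ := by
          rw [← yadd x hx (δ - 1)]; ring_nf
  have Ig : IntervalIntegrable (fun x : ℝ => (legendreP ν (x : ℂ)) ^ 3 *
        ((1 - (x:ℂ) ^ 2) ^ ((ν - 1)/2))) volume (-1) 1 := by
    refine lg_integrable (C := Cp ^ 3) hδ hδ1 (by positivity)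
      ((cP.pow 3).mul (cW _)) fun x hx => ?_
    rw [norm_mul, norm_pow]
    have h3 : ‖legendreP ν x‖ ^ 3 ≤ Cp ^ 3 * (1 - x ^ 2) ^ (-δ) := by
      rw [← y3 x hx, ← mul_pow]
      exact pow_le_pow_left₀ (norm_nonneg _) (bp x hx) 3
    calc _ ≤ (Cp ^ 3 * (1 - x ^ 2) ^ (-δ)) * (1 - x ^ 2) ^ (2 * δ - 1) := by
          have h4 := hW _ _ hs1 x hx
          have h5 : 0 ≤ (1 - x ^ 2) ^ (-δ) := Real.rpow_nonneg (hy0 x hx).le _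
          gcongr
      _ = _ := by
          rw [← yadd x hx (δ - 1)]; ring_nf
  set F : ℝ → ℂ := fun x => (-1 / (8 * (ν + 1))) * ((1 - (x:ℂ) ^ 2) ^ ((ν + 1) / 2) *
    (legendreP (ν + 1) x * (3 * legendreP ν x ^ 2 + 2 * legendreP (ν + 1) x ^ 2))) with hF
  have hD : ∀ x ∈ Set.Ioo (-1:ℝ) 1, HasDerivAt F ((x : ℂ) * (legendreP (ν + 1) (x : ℂ)) ^ 3 *
        ((1 - (x:ℂ) ^ 2) ^ ((ν - 1)/2)) - (3 / 8) * ((legendreP ν (x : ℂ)) ^ 3 *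
        ((1 - (x:ℂ) ^ 2) ^ ((ν - 1)/2)))) x := by
    intro x hx
    obtain ⟨p', q', h1, h2, e1, e2⟩ := dP x hx
    have h3 := ((dW ((ν + 1) / 2) x hx).mul (h2.mul (((h1.pow 2).const_mul 3).add
      ((h2.pow 2).const_mul 2)))).const_mul (-1 / (8 * (ν + 1)))
    refine h3.congr_deriv ?_
    have hne : (1 - (x:ℂ) ^ 2) ≠ 0 := by
      rw [hcast]; exact_mod_cast (hy0 x hx).ne'
    have hs : (1 - (x:ℂ) ^ 2) ^ ((ν + 1) / 2) =
        (1 - (x:ℂ) ^ 2) ^ ((ν - 1) / 2) * (1 - (x:ℂ) ^ 2) := by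
      rw [show (ν + 1) / 2 = (ν - 1) / 2 + 1 by ring, Complex.cpow_add _ _ hne, Complex.cpow_one]
    have hs' : (ν + 1) / 2 - 1 = (ν - 1) / 2 := by ring
    simp only [Pi.add_apply, Pi.mul_apply, Pi.pow_apply, hs, hs']
    generalize (1 - (x:ℂ) ^ 2) ^ ((ν - 1) / 2) = W
    generalize legendreP ν x = p at *
    generalize legendreP (ν + 1) x = q at *
    rw [div_mul_eq_mul_div, div_eq_iff (by simpa using hn)]
    push_cast
    linear_combination (-W * (6 * p * q)) * e1 + (-W * (3 * p ^ 2 + 6 * q ^ 2)) * e2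
  have hFb : ∀ x ∈ Set.Ioo (-1:ℝ) 1, ‖F x‖ ≤ ‖-1 / (8 * (ν + 1))‖ *
      (Cq * (3 * Cp ^ 2 + 2 * Cq ^ 2)) * (1 - x ^ 2) ^ δ := by
    intro x hx
    have hYp : 0 < (1 - x ^ 2) ^ (-(δ / 3)) := Real.rpow_pos_of_pos (hy0 x hx) _
    have hY3 := y3 x hx
    have bp' := bp x hx
    have bq' := bq x hx
    generalize (1 - x ^ 2) ^ (-(δ / 3)) = Y at *
    have h4 : ‖3 * legendreP ν x ^ 2 + 2 * legendreP (ν + 1) x ^ 2‖ ≤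
        3 * (Cp * Y) ^ 2 + 2 * (Cq * Y) ^ 2 := by
      refine (norm_add_le _ _).trans ?_
      rw [norm_mul, norm_mul, norm_pow, norm_pow]
      norm_num
      gcongr
    simp only [hF]
    rw [norm_mul, norm_mul, norm_mul, mul_assoc]
    refine mul_le_mul_of_nonneg_left ?_ (norm_nonneg _)
    calc _ ≤ (1 - x ^ 2) ^ (2 * δ) * ((Cq * Y) * (3 * (Cp * Y) ^ 2 + 2 * (Cq * Y) ^ 2)) := by
          have := hW _ _ hs2 x hx
          gcongr
          exact Real.rpow_nonneg (hy0 x hx).le _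
      _ = (Cq * (3 * Cp ^ 2 + 2 * Cq ^ 2)) * (Y ^ 3 * (1 - x ^ 2) ^ (2 * δ)) := by ring
      _ = _ := by
          rw [hY3, ← yadd x hx δ]; ring_nf
  have hlim : ∀ a : ℝ, a ^ 2 = 1 → Filter.Tendsto (fun x : ℝ => ‖-1 / (8 * (ν + 1))‖ *
      (Cq * (3 * Cp ^ 2 + 2 * Cq ^ 2)) * (1 - x ^ 2) ^ δ) (nhds a) (nhds 0) := by
    intro a ha
    have : Continuous (fun x : ℝ => ‖-1 / (8 * (ν + 1))‖ *
      (Cq * (3 * Cp ^ 2 + 2 * Cq ^ 2)) * (1 - x ^ 2) ^ δ) :=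
      continuous_const.mul ((by fun_prop : Continuous fun x : ℝ => 1 - x ^ 2).rpow_const
        fun _ => Or.inr hδ.le)
    have h := this.tendsto a
    rwa [ha, sub_self, Real.zero_rpow hδ.ne', mul_zero] at h
  have h0 := integral_eq_sub_of_hasDerivAt_of_tendsto (a := -1) (b := 1) (f := F) (fa := 0) (fb := 0)
    (by norm_num) hD (If.sub (Ig.const_mul (3 / 8)))
    (squeeze_zero_norm' (by
      filter_upwards [Ioo_mem_nhdsGT (by norm_num : (-1:ℝ) < 1)] with x hx using hFb x hx)
      ((hlim (-1) (by norm_num)).mono_left nhdsWithin_le_nhds))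
    (squeeze_zero_norm' (by
      filter_upwards [Ioo_mem_nhdsLT (by norm_num : (-1:ℝ) < 1)] with x hx using hFb x hx)
      ((hlim 1 (by norm_num)).mono_left nhdsWithin_le_nhds))
  rw [intervalIntegral.integral_sub If (Ig.const_mul (3 / 8)),
    intervalIntegral.integral_const_mul, sub_zero, sub_eq_zero] at h0
  exact h0
end

section
/- For complex ν with Re ν > -1: ∫_{-1}^1 [P_ν(x)]² P_ν(-x) (1-x²)^{(ν-1)/2} dx = -(8/3) ∫_{-1}^1 x [P_{ν+1}(x)]² P_{ν+1}(-x) (1-x²)^{(ν-1)/2} dx. -/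
open Real MeasureTheory intervalIntegral Complex

namespace S9
open Filter Topology Set Asymptotics

noncomputable def cf (ν : ℂ) : ℕ → ℂ
  | 0 => 1
  | (k+1) => ((k:ℂ) - ν) * (k + 1 + ν) / ((k:ℂ) + 1) ^ 2 * cf ν k

noncomputable def ps (a : ℕ → ℂ) (z : ℂ) : ℂ := ∑' k, a k * z ^ k

lemma nz (k : ℕ) : (k:ℂ) + 1 ≠ 0 := by exact_mod_cast Nat.succ_ne_zero k

lemma coef_eq (ν : ℂ) (k : ℕ) :
    ordinaryHypergeometricCoefficient (-ν) (ν + 1) 1 k = cf ν k := by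
  have h1 : ∀ n : ℕ, (ascPochhammer ℂ n).eval 1 = (n.factorial : ℂ) := fun n => by
    rw [ascPochhammer_eval_one]
  unfold ordinaryHypergeometricCoefficient
  induction k with
  | zero => simp [cf]
  | succ k ih =>
    rw [cf, ← ih, h1, h1, ascPochhammer_succ_eval, ascPochhammer_succ_eval, Nat.factorial_succ]
    have := nz k
    have h2 : (k.factorial : ℂ) ≠ 0 := by exact_mod_cast Nat.factorial_ne_zero k
    push_cast
    field_simp
    ring

lemma legendreP_eq (ν x : ℂ) : legendreP ν x = ps (cf ν) ((1 - x) / 2) := by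
  unfold legendreP ps
  rw [ordinaryHypergeometric_eq_tsum]
  refine tsum_congr fun k => ?_
  rw [← coef_eq, smul_eq_mul]

lemma bdd (ν : ℂ) : ∃ M, ∀ k : ℕ, ‖((k:ℂ) + 1) * cf ν (k+1)‖ ≤ M := by
  set L := ‖ν * (ν + 1)‖
  refine ⟨‖cf ν 1‖ * Real.exp L, ?_⟩
  have key : ∀ k : ℕ, ‖((k:ℂ) + 1) * cf ν (k+1)‖ ≤ ‖cf ν 1‖ * Real.exp (L * (1 - 1 / (k+1))) := by
    intro k
    induction k with
    | zero => simp
    | succ k ih =>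
      have h1 := nz k
      have h2 := nz (k+1)
      have h3 : (((k+1:ℕ):ℂ) + 1) * cf ν (k+1+1) =
          (1 - ν * (ν+1) / (((k:ℂ)+1) * (k + 2))) * (((k:ℂ)+1) * cf ν (k+1)) := by
        rw [cf]
        push_cast at h2 ⊢
        have h2' : (k:ℂ) + 2 ≠ 0 := by convert h2 using 1; ring
        have e : (k:ℂ) + 1 + 1 = k + 2 := by ring
        rw [e]
        field_simp
        ring
      rw [h3, norm_mul]
      have h4 : ‖1 - ν * (ν+1) / (((k:ℂ)+1) * (k + 2))‖ ≤ Real.exp (L * (1/(k+1) - 1/(k+2))) := by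
        refine (norm_sub_le _ _).trans ?_
        have : ‖ν * (ν+1) / (((k:ℂ)+1) * (k + 2))‖ = L * (1/(k+1) - 1/(k+2)) := by
          rw [norm_div, norm_mul ((k:ℂ)+1)]
          have e1 : ‖(k:ℂ)+1‖ = k+1 := by
            have := Complex.norm_natCast (k+1); push_cast at this; exact this
          have e2 : ‖(k:ℂ)+2‖ = k+2 := by
            have := Complex.norm_natCast (k+2); push_cast at this; exact this
          rw [e1, e2]
          have : (k:ℝ)+1 ≠ 0 := by positivity
          have : (k:ℝ)+2 ≠ 0 := by positivity
          field_simp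
          ring
        rw [this, norm_one]
        linarith [Real.add_one_le_exp (L * (1/((k:ℝ)+1) - 1/(k+2)))]
      calc _ ≤ Real.exp (L * (1/(k+1) - 1/(k+2))) * (‖cf ν 1‖ * Real.exp (L * (1 - 1 / (k+1)))) := by
            gcongr
        _ = ‖cf ν 1‖ * (Real.exp (L * (1/(k+1) - 1/(k+2))) * Real.exp (L * (1 - 1 / (k+1)))) := by ring
        _ = _ := by
          rw [← Real.exp_add]
          congr 2
          push_cast
          ring
  intro k
  refine (key k).trans ?_
  have hL : 0 ≤ L := norm_nonneg _
  gcongr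
  have : 0 ≤ 1 / ((k:ℝ)+1) := by positivity
  nlinarith

lemma bdd_cf (ν : ℂ) : ∃ M, ∀ k : ℕ, ‖cf ν k‖ ≤ M := by
  obtain ⟨M, hM⟩ := bdd ν
  refine ⟨max 1 M, fun k => ?_⟩
  cases k with
  | zero => simp [cf]
  | succ k =>
    refine le_trans ?_ ((hM k).trans (le_max_right _ _))
    rw [norm_mul]
    have e1 : ‖(k:ℂ)+1‖ = k+1 := by
      have := Complex.norm_natCast (k+1); push_cast at this; exact this
    rw [e1]
    nlinarith [norm_nonneg (cf ν (k+1)), (Nat.cast_nonneg k : (0:ℝ) ≤ k)]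

lemma summ {a : ℕ → ℂ} {M : ℝ} (h : ∀ k, ‖a k‖ ≤ M) {z : ℂ} (hz : ‖z‖ < 1) :
    Summable fun k => a k * z ^ k := by
  refine Summable.of_norm_bounded ((summable_geometric_of_lt_one (norm_nonneg z) hz).mul_left M) ?_
  intro k
  rw [norm_mul, norm_pow]
  gcongr
  exact h k

lemma deriv_ps {a : ℕ → ℂ} {M : ℝ} (h : ∀ k, ‖a k‖ ≤ M) {z : ℂ} (hz : ‖z‖ < 1) :
    HasDerivAt (ps a) (ps (fun k => ((k:ℂ)+1) * a (k+1)) z) z := by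
  obtain ⟨r, hr1, hr2⟩ := exists_between hz
  have hr0 : 0 ≤ r := (norm_nonneg z).trans hr1.le
  have hM : 0 ≤ M := (norm_nonneg _).trans (h 0)
  have hu : Summable fun k : ℕ => M * ((k:ℝ) * r ^ (k-1)) := by
    refine Summable.mul_left _ ?_
    rw [← summable_nat_add_iff 1]
    have h1 := summable_pow_mul_geometric_of_norm_lt_one (R := ℝ) 1 (r := r) (by rwa [Real.norm_of_nonneg hr0])
    have h2 := summable_geometric_of_lt_one hr0 hr2
    refine (h1.add h2).congr fun k => ?_
    simp
    ring
  have H := hasDerivAt_tsum_of_isPreconnected (𝕜 := ℂ) (F := ℂ) (g := fun k z => a k * z ^ k)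
    (g' := fun k z => a k * (k * z ^ (k-1))) (t := Metric.ball 0 r) (y₀ := 0) (y := z) hu
    Metric.isOpen_ball (convex_ball _ _).isPreconnected
    (fun n y _ => (hasDerivAt_pow n y).const_mul (a n)) ?_ ?_ ?_ ?_
  · have e : ps (fun k => ((k:ℂ)+1) * a (k+1)) z = ∑' k : ℕ, a k * (k * z ^ (k-1)) := ?_
    · rw [e]; exact H
    unfold ps
    have hs : Summable fun k : ℕ => a k * (k * z ^ (k-1)) := by
      refine Summable.of_norm_bounded hu fun k => ?_
      rw [norm_mul, norm_mul, norm_pow, Complex.norm_natCast]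
      gcongr
      exact h k
    rw [hs.tsum_eq_zero_add]
    simp
    refine tsum_congr fun k => ?_
    ring
  · intro k y hy
    have : ‖y‖ ≤ r := by simpa using (Metric.mem_ball.1 hy).le
    rw [norm_mul, norm_mul, norm_pow, Complex.norm_natCast]
    gcongr
    exact h k
  · simpa using (norm_nonneg z).trans_lt hr1
  · exact summ h (by simp)
  · simpa using hr1

noncomputable def F (ν z : ℂ) : ℂ := ps (cf ν) z
noncomputable def G (ν z : ℂ) : ℂ := ps (fun k => ((k:ℂ)+1) * cf ν (k+1)) z

lemma F_deriv (ν : ℂ) {z : ℂ} (hz : ‖z‖ < 1) : HasDerivAt (F ν) (G ν z) z := by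
  obtain ⟨M, hM⟩ := bdd_cf ν
  exact deriv_ps hM hz

/-- coefficients of `z (1-z) F'` -/
noncomputable def df (ν : ℂ) : ℕ → ℂ
  | 0 => 0
  | (k+1) => - (ν * (ν+1)) * cf ν k / ((k:ℂ) + 1)

lemma bdd_df (ν : ℂ) : ∃ M, ∀ k : ℕ, ‖df ν k‖ ≤ M := by
  obtain ⟨M, hM⟩ := bdd_cf ν
  have hM0 : 0 ≤ M := (norm_nonneg _).trans (hM 0)
  refine ⟨‖ν * (ν+1)‖ * M, fun k => ?_⟩
  cases k with
  | zero => simp [df]; positivity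
  | succ k =>
    rw [df, norm_div, norm_mul, norm_neg]
    have e1 : ‖(k:ℂ)+1‖ = k+1 := by
      have := Complex.norm_natCast (k+1); push_cast at this; exact this
    rw [e1]
    refine (div_le_self (by positivity) (by simp)).trans ?_
    gcongr
    exact hM k

lemma ps_shift {a : ℕ → ℂ} {M : ℝ} (h : ∀ k, ‖a k‖ ≤ M) {z : ℂ} (hz : ‖z‖ < 1) :
    ps a z = a 0 + z * ps (fun k => a (k+1)) z := by
  unfold ps
  rw [(summ h hz).tsum_eq_zero_add, ← tsum_mul_left]
  simp
  refine tsum_congr fun k => ?_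
  ring

lemma U_eq (ν : ℂ) {z : ℂ} (hz : ‖z‖ < 1) : z * (1 - z) * G ν z = ps (df ν) z := by
  obtain ⟨M, hM⟩ := bdd ν
  obtain ⟨M', hM'⟩ := bdd_df ν
  rw [ps_shift hM' hz]
  have h1 : (1 - z) * G ν z = ps (fun k => df ν (k+1)) z := by
    have e := ps_shift (fun k => hM' (k+1)) hz
    have e2 := ps_shift hM hz
    have e3 : ps (fun k => df ν (k+1+1)) z =
       ps (fun k => ((k+1:ℕ):ℂ) * cf ν (k+1) * 0 + (((k+1:ℕ):ℂ)+1) * cf ν (k+1+1)) z - G ν z := by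
      unfold ps G ps
      rw [← (summ _ hz).tsum_sub (summ hM hz)]
      · refine tsum_congr fun k => ?_
        simp only [df]
        have h1 := nz k
        have h2 := nz (k+1)
        have h3 : cf ν (k+1+1) = (((k+1:ℕ):ℂ) - ν) * ((k+1:ℕ) + 1 + ν) / (((k+1:ℕ):ℂ) + 1) ^ 2
          * cf ν (k+1) := rfl
        rw [h3]
        field_simp
        push_cast
        ring
      · exact M
      · intro k
        simpa using hM (k+1)
    rw [e, e3]
    simp only [mul_zero, zero_add]
    unfold G
    rw [sub_mul, one_mul]
    nth_rw 1 [e2]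
    simp [df, cf]
    ring
  rw [mul_assoc, h1]
  simp [df]

lemma U_deriv (ν : ℂ) {z : ℂ} (hz : ‖z‖ < 1) :
    HasDerivAt (fun z => z * (1 - z) * G ν z) (-(ν * (ν+1)) * F ν z) z := by
  obtain ⟨M', hM'⟩ := bdd_df ν
  have H := deriv_ps hM' hz
  have e : ps (fun k => ((k:ℂ)+1) * df ν (k+1)) z = -(ν * (ν+1)) * F ν z := by
    unfold F ps
    rw [← tsum_mul_left]
    refine tsum_congr fun k => ?_
    simp only [df]
    have := nz k
    field_simp
  rw [e] at H
  refine H.congr_of_eventuallyEq ?_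
  have : Metric.ball (0:ℂ) 1 ∈ 𝓝 z := Metric.isOpen_ball.mem_nhds (by simpa using hz)
  filter_upwards [this] with y hy
  exact U_eq ν (by simpa using hy)

lemma cf_next (ν : ℂ) (k : ℕ) :
    cf (ν+1) (k+1) = -(ν + k + 1) * (ν + k + 2) / ((k:ℂ)+1)^2 * cf ν k := by
  induction k with
  | zero => simp only [cf]; push_cast; ring
  | succ k ih =>
    rw [cf, ih, cf]
    have := nz k
    have := nz (k+1)
    field_simp
    push_cast
    ring

lemma contig (ν : ℂ) (h : ν + 1 ≠ 0) {z : ℂ} (hz : ‖z‖ < 1) :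
    F (ν+1) z = (1 - 2 * z) * F ν z + 2 / (ν+1) * (z * (1 - z) * G ν z) := by
  obtain ⟨M', hM'⟩ := bdd_df ν
  obtain ⟨M, hM⟩ := bdd_cf ν
  obtain ⟨M1, hM1⟩ := bdd_cf (ν+1)
  rw [U_eq ν hz, ps_shift hM' hz]
  have e1 : F (ν+1) z = 1 + z * ps (fun k => cf (ν+1) (k+1)) z := ps_shift hM1 hz
  have e2 : F ν z = 1 + z * ps (fun k => cf ν (k+1)) z := ps_shift hM hz
  have e3 : ps (fun k => cf (ν+1) (k+1)) z = ps (fun k => cf ν (k+1)) z - 2 * F ν z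
      + 2 / (ν+1) * ps (fun k => df ν (k+1)) z := by
    have s1 := summ (fun k => hM (k+1)) hz
    have s2 := (summ hM hz).mul_left 2
    have s3 := (summ (fun k => hM' (k+1)) hz).mul_left (2/(ν+1))
    unfold F ps
    rw [← tsum_mul_left, ← tsum_mul_left, ← s1.tsum_sub s2, ← (s1.sub s2).tsum_add s3]
    refine tsum_congr fun k => ?_
    simp only []
    rw [cf_next ν, cf, df]
    have := nz k
    field_simp
    ring
  rw [e1, e3, sub_mul, one_mul]
  nth_rw 2 [e2]
  simp [df]
  ring

lemma F_bound (ν : ℂ) {ε : ℝ} (hε : 0 < ε) : ∃ C, ∀ t : ℝ, 0 < t → t < 1 →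
    ‖F ν t‖ ≤ C * (t * (1 - t)) ^ (-ε) := by
  obtain ⟨M, hM⟩ := bdd ν
  have hM0 : 0 ≤ M := (norm_nonneg _).trans (hM 0)
  obtain ⟨M1, hM1⟩ := bdd_cf ν
  refine ⟨1 + M / ε, fun t h0 h1 => ?_⟩
  have ht : ‖(t:ℂ)‖ < 1 := by simpa [abs_of_pos h0] using h1
  have hp : 0 < t * (1 - t) := mul_pos h0 (by linarith)
  have hN1 : 1 ≤ (t * (1 - t)) ^ (-ε) :=
    Real.one_le_rpow_of_pos_of_le_one_of_nonpos hp (by nlinarith) (by linarith)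
  have e : F ν t = 1 + t * ps (fun k => cf ν (k+1)) t := ps_shift hM1 ht
  have hl := Real.hasSum_pow_div_log_of_abs_lt_one (x := t) (by rwa [abs_of_pos h0])
  have b : ‖t * ps (fun k => cf ν (k+1)) t‖ ≤ M * (-Real.log (1 - t)) := by
    unfold ps
    rw [← tsum_mul_left]
    refine tsum_of_norm_bounded (hl.mul_left M) fun k => ?_
    have := hM k
    rw [norm_mul] at this
    have e1 : ‖(k:ℂ)+1‖ = k+1 := by
      have := Complex.norm_natCast (k+1); push_cast at this; exact this
    rw [e1] at this
    have hk : (0:ℝ) < k + 1 := by positivity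
    rw [norm_mul, norm_mul, norm_pow]
    simp only [Complex.norm_real, Real.norm_of_nonneg h0.le]
    rw [← mul_div_assoc, le_div_iff₀ hk]
    calc _ = (((k:ℝ)+1) * ‖cf ν (k+1)‖) * t^(k+1) := by ring
      _ ≤ _ := by gcongr
  have b2 : -Real.log (1 - t) ≤ (t * (1 - t)) ^ (-ε) / ε := by
    have h2 : 0 < 1 - t := by linarith
    have := Real.log_le_rpow_div (x := (1-t)⁻¹) (by positivity) hε
    rw [Real.log_inv] at this
    refine this.trans ?_
    gcongr
    rw [Real.inv_rpow h2.le, ← Real.rpow_neg h2.le]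
    exact Real.rpow_le_rpow_of_nonpos hp (by nlinarith) (by linarith)
  rw [e]
  refine (norm_add_le _ _).trans ?_
  rw [norm_one, add_mul]
  have : M * (-Real.log (1 - t)) ≤ M / ε * (t * (1 - t)) ^ (-ε) := by
    calc _ ≤ M * ((t * (1 - t)) ^ (-ε) / ε) := by gcongr
      _ = _ := by ring
  linarith

lemma U_bound (ν : ℂ) : ∃ C, ∀ t : ℝ, 0 < t → t < 1 →
    ‖(t:ℂ) * (1 - t) * G ν t‖ ≤ C := by
  obtain ⟨M, hM⟩ := bdd ν
  have hM0 : 0 ≤ M := (norm_nonneg _).trans (hM 0)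
  refine ⟨M, fun t h0 h1 => ?_⟩
  have h2 : 0 < 1 - t := by linarith
  have b : ‖G ν t‖ ≤ M * (1 - t)⁻¹ := by
    unfold G ps
    refine tsum_of_norm_bounded ((hasSum_geometric_of_lt_one h0.le h1).mul_left M) fun k => ?_
    rw [norm_mul, norm_pow]
    simp only [Complex.norm_real, Real.norm_of_nonneg h0.le]
    gcongr
    exact hM k
  have e : ‖(t:ℂ) * (1 - t)‖ = t * (1 - t) := by
    rw [← Complex.ofReal_one, ← Complex.ofReal_sub, ← Complex.ofReal_mul, Complex.norm_real,
      Real.norm_of_nonneg (by positivity)]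
  rw [norm_mul, e]
  calc _ ≤ t * (1 - t) * (M * (1 - t)⁻¹) := by gcongr
    _ = t * M := by field_simp
    _ ≤ M := by nlinarith

noncomputable def T (t : ℝ) : ℝ := t * (1 - t)

lemma T_pos {t : ℝ} (ht : t ∈ Ioo (0:ℝ) 1) : 0 < T t := mul_pos ht.1 (by linarith [ht.2])

lemma nrm {t : ℝ} (ht : t ∈ Ioo (0:ℝ) 1) : ‖(t:ℂ)‖ < 1 := by
  simpa [abs_of_pos ht.1] using ht.2

lemma refl_mem {t : ℝ} (ht : t ∈ Ioo (0:ℝ) 1) : 1 - t ∈ Ioo (0:ℝ) 1 :=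
  ⟨by linarith [ht.2], by linarith [ht.1]⟩

lemma nrm' {t : ℝ} (ht : t ∈ Ioo (0:ℝ) 1) : ‖1 - (t:ℂ)‖ < 1 := by
  have := nrm (refl_mem ht)
  push_cast at this; exact this

lemma integrable_of_bigO {f : ℝ → ℂ} (hc : ContinuousOn f (Ioo 0 1)) {r : ℝ} (hr : -1 < r)
    (h : f =O[𝓟 (Ioo (0:ℝ) 1)] fun t => T t ^ r) : IntervalIntegrable f volume 0 1 := by
  obtain ⟨C, hC⟩ := isBigO_principal.1 h
  have hb := Complex.betaIntegral_convergent (u := ((r+1:ℝ):ℂ)) (v := ((r+1:ℝ):ℂ))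
    (by simp; linarith) (by simp; linarith)
  rw [intervalIntegrable_iff_integrableOn_Ioo_of_le zero_le_one] at hb ⊢
  refine Integrable.mono' (hb.norm.const_mul C) (hc.aestronglyMeasurable measurableSet_Ioo) ?_
  filter_upwards [ae_restrict_mem measurableSet_Ioo] with t ht
  refine (hC t ht).trans (le_of_eq ?_)
  have h1 : 0 < 1 - t := by linarith [ht.2]
  rw [Real.norm_of_nonneg (Real.rpow_nonneg (T_pos ht).le _), norm_mul,
    Complex.norm_cpow_eq_rpow_re_of_pos ht.1]
  have : ((1:ℂ) - t) = ((1 - t : ℝ) : ℂ) := by push_cast; rfl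
  rw [this, Complex.norm_cpow_eq_rpow_re_of_pos h1, T, Real.mul_rpow ht.1.le h1.le]
  simp

lemma tendsto_of_bigO {f : ℝ → ℂ} {r : ℝ} (hr : 0 < r)
    (h : f =O[𝓟 (Ioo (0:ℝ) 1)] fun t => T t ^ r) :
    Tendsto f (𝓝[>] 0) (𝓝 0) ∧ Tendsto f (𝓝[<] 1) (𝓝 0) := by
  have hcont : Continuous fun t => T t ^ r := by
    unfold T
    exact Continuous.rpow_const (by fun_prop) (fun _ => Or.inr hr.le)
  have h0 : Tendsto (fun t => T t ^ r) (𝓝 0) (𝓝 0) := by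
    have := hcont.tendsto 0
    simpa [T, Real.zero_rpow hr.ne'] using this
  have h1 : Tendsto (fun t => T t ^ r) (𝓝 1) (𝓝 0) := by
    have := hcont.tendsto 1
    simpa [T, Real.zero_rpow hr.ne'] using this
  constructor
  · exact (h.mono (le_principal_iff.2 (Ioo_mem_nhdsGT one_pos))).trans_tendsto
      (h0.mono_left nhdsWithin_le_nhds)
  · exact (h.mono (le_principal_iff.2 (Ioo_mem_nhdsLT one_pos))).trans_tendsto
      (h1.mono_left nhdsWithin_le_nhds)

lemma w_bigO (μ : ℂ) : (fun t : ℝ => (4 * (t:ℂ) * (1 - t)) ^ μ) =O[𝓟 (Ioo (0:ℝ) 1)]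
    fun t => T t ^ μ.re := by
  refine isBigO_principal.2 ⟨4 ^ μ.re, fun t ht => ?_⟩
  have e : 4 * (t:ℂ) * (1 - t) = ((4 * T t : ℝ) : ℂ) := by unfold T; push_cast; ring
  have := T_pos ht
  rw [e, Complex.norm_cpow_eq_rpow_re_of_pos (by positivity), Real.mul_rpow (by norm_num) this.le,
    Real.norm_of_nonneg (Real.rpow_nonneg this.le _)]

lemma F_bigO (ν : ℂ) {ε : ℝ} (hε : 0 < ε) :
    (fun t : ℝ => F ν t) =O[𝓟 (Ioo (0:ℝ) 1)] fun t => T t ^ (-ε) := by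
  obtain ⟨C, hC⟩ := F_bound ν hε
  refine isBigO_principal.2 ⟨C, fun t ht => ?_⟩
  rw [Real.norm_of_nonneg (Real.rpow_nonneg (T_pos ht).le _)]
  exact hC t ht.1 ht.2

lemma F_bigO' (ν : ℂ) {ε : ℝ} (hε : 0 < ε) :
    (fun t : ℝ => F ν (1 - t)) =O[𝓟 (Ioo (0:ℝ) 1)] fun t => T t ^ (-ε) := by
  obtain ⟨C, hC⟩ := F_bound ν hε
  refine isBigO_principal.2 ⟨C, fun t ht => ?_⟩
  rw [Real.norm_of_nonneg (Real.rpow_nonneg (T_pos ht).le _)]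
  have := hC (1-t) (refl_mem ht).1 (refl_mem ht).2
  push_cast at this
  unfold T
  convert this using 3
  ring

lemma one_le_T {ε : ℝ} (hε : 0 < ε) {t : ℝ} (ht : t ∈ Ioo (0:ℝ) 1) : 1 ≤ T t ^ (-ε) :=
  Real.one_le_rpow_of_pos_of_le_one_of_nonpos (T_pos ht)
    (by unfold T; nlinarith [ht.1, ht.2]) (by linarith)

lemma bigO_of_bdd {f : ℝ → ℂ} {ε : ℝ} (hε : 0 < ε) {C : ℝ}
    (h : ∀ t ∈ Ioo (0:ℝ) 1, ‖f t‖ ≤ C) :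
    f =O[𝓟 (Ioo (0:ℝ) 1)] fun t => T t ^ (-ε) := by
  refine isBigO_principal.2 ⟨C, fun t ht => ?_⟩
  have h1 := one_le_T hε ht
  rw [Real.norm_of_nonneg (by linarith)]
  have : 0 ≤ C := (norm_nonneg _).trans (h t ht)
  nlinarith [h t ht]

noncomputable def u (ν z : ℂ) : ℂ := -2 * (z * (1 - z) * G ν z)
noncomputable def v (ν z : ℂ) : ℂ := 2 * ((1 - z) * (1 - (1 - z)) * G ν (1 - z))

lemma u_bigO (ν : ℂ) {ε : ℝ} (hε : 0 < ε) :
    (fun t : ℝ => u ν t) =O[𝓟 (Ioo (0:ℝ) 1)] fun t => T t ^ (-ε) := by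
  obtain ⟨C, hC⟩ := U_bound ν
  refine bigO_of_bdd (C := 2 * C) hε fun t ht => ?_
  have := hC t ht.1 ht.2
  rw [u, norm_mul]
  simpa using this

lemma v_bigO (ν : ℂ) {ε : ℝ} (hε : 0 < ε) :
    (fun t : ℝ => v ν t) =O[𝓟 (Ioo (0:ℝ) 1)] fun t => T t ^ (-ε) := by
  obtain ⟨C, hC⟩ := U_bound ν
  refine bigO_of_bdd (C := 2 * C) hε fun t ht => ?_
  have := hC (1-t) (refl_mem ht).1 (refl_mem ht).2
  push_cast at this
  rw [v, norm_mul]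
  simpa using this

lemma Fr_deriv (ν : ℂ) {z : ℂ} (hz : ‖1 - z‖ < 1) :
    HasDerivAt (fun z => F ν (1 - z)) (- G ν (1 - z)) z :=
  (F_deriv ν hz).comp_const_sub 1 z

lemma u_deriv (ν : ℂ) {z : ℂ} (hz : ‖z‖ < 1) :
    HasDerivAt (u ν) (2 * (ν * (ν+1)) * F ν z) z := by
  refine ((U_deriv ν hz).const_mul (-2)).congr_deriv ?_
  ring

lemma v_deriv (ν : ℂ) {z : ℂ} (hz : ‖1 - z‖ < 1) :
    HasDerivAt (v ν) (2 * (ν * (ν+1)) * F ν (1 - z)) z := by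
  refine (((U_deriv ν hz).comp_const_sub 1 z).const_mul 2).congr_deriv ?_
  ring

noncomputable def K (ν z : ℂ) : ℂ :=
  (1 - 2*z) * (3 + 2 * (1 - 2*z)^2) / (3 * (ν+1)) * (F ν z * F ν z * F ν (1-z))
  + -(1 + 2 * (1 - 2*z)^2) / (3 * (ν+1)^2) *
      (F ν z * F ν z * v ν z + 2 * (F ν z * F ν (1-z) * u ν z))
  + 2 * (1 - 2*z) / (3 * (ν+1)^3) *
      (F ν (1-z) * u ν z * u ν z + 2 * (F ν z * u ν z * v ν z))
  + -2 / (3 * (ν+1)^4) * (u ν z * u ν z * v ν z)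

noncomputable def Phi (ν z : ℂ) : ℂ := (4 * z * (1 - z)) ^ ((ν+1)/2) * K ν z

noncomputable def J1 (ν z : ℂ) : ℂ :=
  F ν z ^ 2 * F ν (1-z) * (4 * z * (1 - z)) ^ ((ν-1)/2)
noncomputable def J2 (ν z : ℂ) : ℂ :=
  (1 - 2*z) * F (ν+1) z ^ 2 * F (ν+1) (1-z) * (4 * z * (1 - z)) ^ ((ν-1)/2)

lemma Phi_deriv (ν : ℂ) (hm : ν + 1 ≠ 0) {z : ℂ} (hz : ‖z‖ < 1) (hz' : ‖1 - z‖ < 1)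
    (hs : 4 * z * (1 - z) ∈ Complex.slitPlane) :
    HasDerivAt (Phi ν) (-2 * (J1 ν z + 8/3 * J2 ν z)) z := by
  have dp := F_deriv ν hz
  have dq := Fr_deriv ν hz'
  have du := u_deriv ν hz
  have dv := v_deriv ν hz'
  have dX : HasDerivAt (fun z : ℂ => 1 - 2*z) (-2) z := by
    simpa using ((hasDerivAt_id z).const_mul 2).const_sub 1
  have ds : HasDerivAt (fun z : ℂ => 4 * z * (1 - z)) (4 - 8 * z) z := by
    refine (((hasDerivAt_id z).const_mul 4).mul ((hasDerivAt_id z).const_sub 1)).congr_deriv ?_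
    simp only [id]; ring
  have dw := ds.cpow_const (c := (ν+1)/2) hs
  have d1 := ((dX.mul (((dX.pow 2).const_mul 2).const_add 3)).div_const (3 * (ν+1))).mul
    ((dp.mul dp).mul dq)
  have d2 := (((((dX.pow 2).const_mul 2).const_add 1).neg).div_const (3 * (ν+1)^2)).mul
    (((dp.mul dp).mul dv).add (((dp.mul dq).mul du).const_mul 2))
  have d3 := ((dX.const_mul 2).div_const (3 * (ν+1)^3)).mul
    (((dq.mul du).mul du).add (((dp.mul du).mul dv).const_mul 2))
  have d4 := ((du.mul du).mul dv).const_mul (-2 / (3 * (ν+1)^4))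
  have D := dw.mul (((d1.add d2).add d3).add d4)
  have hs0 : 4 * z * (1 - z) ≠ 0 := Complex.slitPlane_ne_zero hs
  have e1 : (ν+1)/2 - 1 = (ν-1)/2 := by ring
  have e2 : (4 * z * (1 - z)) ^ ((ν+1)/2) = (4 * z * (1 - z)) ^ ((ν-1)/2) * (4 * z * (1 - z)) := by
    rw [← e1, Complex.cpow_sub _ _ hs0, Complex.cpow_one, div_mul_cancel₀ _ hs0]
  have c1 := contig ν hm hz
  have c2 := contig ν hm hz'
  refine (D.congr_deriv ?_)
  simp only [Pi.mul_apply, Pi.add_apply, Pi.pow_apply, Pi.neg_apply]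
  rw [e1, e2, J1, J2, c1, c2, u, v]
  generalize (4 * z * (1 - z)) ^ ((ν-1)/2) = w
  generalize F ν z = p
  generalize F ν (1 - z) = q
  generalize G ν z = a
  generalize G ν (1 - z) = b
  field_simp
  ring

lemma slit {t : ℝ} (ht : t ∈ Ioo (0:ℝ) 1) : 4 * (t:ℂ) * (1 - t) ∈ Complex.slitPlane := by
  have e : 4 * (t:ℂ) * (1 - t) = ((4 * T t : ℝ) : ℂ) := by unfold T; push_cast; ring
  rw [e, Complex.ofReal_mem_slitPlane]
  have := T_pos ht
  positivity

lemma mul3 {f g h : ℝ → ℂ} {ε : ℝ}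
    (hf : f =O[𝓟 (Ioo (0:ℝ) 1)] fun t => T t ^ (-ε))
    (hg : g =O[𝓟 (Ioo (0:ℝ) 1)] fun t => T t ^ (-ε))
    (hh : h =O[𝓟 (Ioo (0:ℝ) 1)] fun t => T t ^ (-ε)) :
    (fun t => f t * g t * h t) =O[𝓟 (Ioo (0:ℝ) 1)] fun t => T t ^ (-(3*ε)) := by
  refine ((hf.mul hg).mul hh).congr' (EventuallyEq.refl _ _) ?_
  refine eventuallyEq_of_mem (mem_principal_self _) fun t ht => ?_
  have := T_pos ht
  rw [← Real.rpow_add this, ← Real.rpow_add this]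
  congr 1
  ring

lemma mulw {f : ℝ → ℂ} {r : ℝ} (μ : ℂ)
    (hf : f =O[𝓟 (Ioo (0:ℝ) 1)] fun t => T t ^ (-r)) :
    (fun t : ℝ => (4 * (t:ℂ) * (1 - t)) ^ μ * f t) =O[𝓟 (Ioo (0:ℝ) 1)]
      fun t => T t ^ (μ.re - r) := by
  refine ((w_bigO μ).mul hf).congr' (EventuallyEq.refl _ _) ?_
  refine eventuallyEq_of_mem (mem_principal_self _) fun t ht => ?_
  have := T_pos ht
  rw [← Real.rpow_add this]
  congr 1

lemma mulc {f : ℝ → ℂ} {r : ℝ} {c : ℂ → ℂ} (hc : Continuous c)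
    (hf : f =O[𝓟 (Ioo (0:ℝ) 1)] fun t => T t ^ r) :
    (fun t : ℝ => c t * f t) =O[𝓟 (Ioo (0:ℝ) 1)] fun t => T t ^ r := by
  have h1 : (fun t : ℝ => c t) =O[𝓟 (Ioo (0:ℝ) 1)] fun _ => (1:ℝ) := by
    have hc' : Continuous fun t : ℝ => c t := hc.comp Complex.continuous_ofReal
    obtain ⟨C, hC⟩ := isCompact_Icc.exists_bound_of_continuousOn (s := Icc (0:ℝ) 1) hc'.continuousOn
    refine isBigO_principal.2 ⟨C, fun t ht => ?_⟩
    simpa using hC t (Ioo_subset_Icc_self ht)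
  simpa using h1.mul hf

lemma K_bigO (ν : ℂ) {ε : ℝ} (hε : 0 < ε) :
    (fun t : ℝ => K ν t) =O[𝓟 (Ioo (0:ℝ) 1)] fun t => T t ^ (-(3*ε)) := by
  have hp := F_bigO ν hε
  have hq := F_bigO' ν hε
  have hu := u_bigO ν hε
  have hv := v_bigO ν hε
  have k1 := mulc (c := fun z => (1 - 2*z) * (3 + 2 * (1 - 2*z)^2) / (3 * (ν+1)))
    (by fun_prop) (mul3 hp hp hq)
  have k2 := mulc (c := fun z => -(1 + 2 * (1 - 2*z)^2) / (3 * (ν+1)^2))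
    (by fun_prop) ((mul3 hp hp hv).add ((mul3 hp hq hu).const_mul_left 2))
  have k3 := mulc (c := fun z => 2 * (1 - 2*z) / (3 * (ν+1)^3))
    (by fun_prop) ((mul3 hq hu hu).add ((mul3 hp hu hv).const_mul_left 2))
  have k4 := (mul3 hu hu hv).const_mul_left (-2 / (3 * (ν+1)^4))
  exact ((k1.add k2).add k3).add k4

lemma cont_w (μ : ℂ) : ContinuousOn (fun t : ℝ => (4 * (t:ℂ) * (1 - t)) ^ μ) (Ioo 0 1) :=
  ContinuousOn.cpow_const (by fun_prop) fun _ ht => slit ht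

lemma cont_F (ν : ℂ) : ContinuousOn (fun t : ℝ => F ν t) (Ioo 0 1) := fun _ ht =>
  (F_deriv ν (nrm ht)).comp_ofReal.continuousAt.continuousWithinAt

lemma cont_F' (ν : ℂ) : ContinuousOn (fun t : ℝ => F ν (1 - t)) (Ioo 0 1) := fun _ ht =>
  (Fr_deriv ν (nrm' ht)).comp_ofReal.continuousAt.continuousWithinAt

lemma main (ν : ℂ) (hν : -1 < ν.re) :
    (∫ t in (0:ℝ)..1, J1 ν t) = -(8/3) * ∫ t in (0:ℝ)..1, J2 ν t := by
  have hm : ν + 1 ≠ 0 := by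
    intro h
    have := congrArg Complex.re h
    simp at this
    linarith
  obtain ⟨ε, hε, hε2⟩ : ∃ ε : ℝ, 0 < ε ∧ 3 * ε < (ν.re + 1) / 2 :=
    ⟨(ν.re + 1) / 12, by linarith, by linarith⟩
  have r1 : ((ν-1)/2).re = (ν.re - 1)/2 := by
    have : (ν-1)/2 = (ν-1)/((2:ℝ):ℂ) := by push_cast; rfl
    rw [this, Complex.div_ofReal_re]; simp
  have r2 : ((ν+1)/2).re = (ν.re + 1)/2 := by
    have : (ν+1)/2 = (ν+1)/((2:ℝ):ℂ) := by push_cast; rfl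
    rw [this, Complex.div_ofReal_re]; simp
  have i1 : IntervalIntegrable (fun t : ℝ => J1 ν t) volume 0 1 := by
    refine integrable_of_bigO (r := ((ν-1)/2).re - 3*ε) ?_ (by rw [r1]; linarith) ?_
    · exact (((cont_F ν).pow 2).mul (cont_F' ν)).mul (cont_w _)
    · refine (mulw ((ν-1)/2) (mul3 (F_bigO ν hε) (F_bigO ν hε) (F_bigO' ν hε))).congr_left ?_
      intro t; simp only [J1]; ring
  have i2 : IntervalIntegrable (fun t : ℝ => J2 ν t) volume 0 1 := by
    refine integrable_of_bigO (r := ((ν-1)/2).re - 3*ε) ?_ (by rw [r1]; linarith) ?_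
    · refine ContinuousOn.mul (ContinuousOn.mul (ContinuousOn.mul (by fun_prop)
        ((cont_F _).pow 2)) (cont_F' _)) (cont_w _)
    · refine (mulc (c := fun z => 1 - 2 * z) (by fun_prop) (mulw ((ν-1)/2)
        (mul3 (F_bigO (ν+1) hε) (F_bigO (ν+1) hε) (F_bigO' (ν+1) hε)))).congr_left ?_
      intro t; simp only [J2]; ring
  have hPhi : (fun t : ℝ => Phi ν t) =O[𝓟 (Ioo (0:ℝ) 1)]
      fun t => T t ^ (((ν+1)/2).re - 3*ε) := mulw ((ν+1)/2) (K_bigO ν hε)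
  obtain ⟨l0, l1⟩ := tendsto_of_bigO (by rw [r2]; linarith) hPhi
  have H := intervalIntegral.integral_eq_sub_of_hasDerivAt_of_tendsto (a := 0) (b := 1)
    (f := fun t : ℝ => Phi ν t) (f' := fun t : ℝ => -2 * (J1 ν t + 8/3 * J2 ν t))
    one_pos (fun t ht => (Phi_deriv ν hm (nrm ht) (nrm' ht) (slit ht)).comp_ofReal)
    ((i1.add (i2.const_mul (8/3))).const_mul (-2)) l0 l1
  rw [intervalIntegral.integral_const_mul, intervalIntegral.integral_add i1 (i2.const_mul (8/3)),
    intervalIntegral.integral_const_mul] at H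
  linear_combination (-1/2) * H

lemma subst (f : ℝ → ℂ) : ∫ x in (-1:ℝ)..1, f x = 2 * ∫ t in (0:ℝ)..1, f (1 - 2 * t) := by
  rw [intervalIntegral.integral_comp_sub_mul f two_ne_zero 1]
  norm_num
  ring

end S9

theorem stmt9 (ν : ℂ) (hν : -1 < ν.re) :
    (∫ x in (-1:ℝ)..1, (legendreP ν (x : ℂ)) ^ 2 * legendreP ν (-(x : ℂ)) *
        ((1 - (x:ℂ) ^ 2) ^ ((ν - 1)/2)))
      = -(8/3) * ∫ x in (-1:ℝ)..1, (x : ℂ) * (legendreP (ν + 1) (x : ℂ)) ^ 2 *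
          legendreP (ν + 1) (-(x : ℂ)) * ((1 - (x:ℂ) ^ 2) ^ ((ν - 1)/2)) := by
  rw [S9.subst, S9.subst]
  have h := S9.main ν hν
  have e1 : ∀ t : ℝ, (1 - ((1 - 2 * t : ℝ) : ℂ)) / 2 = t := fun t => by push_cast; ring
  have e2 : ∀ t : ℝ, (1 - -((1 - 2 * t : ℝ) : ℂ)) / 2 = 1 - t := fun t => by push_cast; ring
  have e3 : ∀ t : ℝ, 1 - ((1 - 2 * t : ℝ) : ℂ) ^ 2 = 4 * t * (1 - t) := fun t => by
    push_cast; ring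
  have e4 : ∀ t : ℝ, ((1 - 2 * t : ℝ) : ℂ) = 1 - 2 * t := fun t => by push_cast; ring
  simp only [S9.legendreP_eq, e1, e2, e3]
  simp only [e4]
  simp only [S9.J1, S9.J2, S9.F] at h
  rw [h]
  ring
end

section
/- For complex ν with Re ν > -1: ∫_{-1}^1 [P_ν(x)]² P_ν(-x) (1-x²)^{(ν-1)/2} dx = -(64 (ν+2)⁴ / (ν+1)⁴) ∫_{-1}^1 [P_{ν+2}(x)]² P_{ν+2}(-x) (1-x²)^{(ν+1)/2} dx. -/
open Real MeasureTheory intervalIntegral Complex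

/-- coefficients of the series of `P_ν` -/
noncomputable def lc (ν : ℂ) (n : ℕ) : ℂ := ordinaryHypergeometricCoefficient (-ν) (ν + 1) 1 n

/-- coefficients of the series of `(1-x²) P_ν'/(ν+1)` -/
noncomputable def lh (ν : ℂ) : ℕ → ℂ
  | 0 => 0
  | (n + 1) => 2 * ν * lc ν n / (n + 1)

lemma lc_zero (ν : ℂ) : lc ν 0 = 1 := by
  simp [lc, ordinaryHypergeometricCoefficient]

lemma lc_succ (ν : ℂ) (n : ℕ) :
    lc ν (n + 1) = lc ν n * ((n - ν) * (n + 1 + ν) / ((n : ℂ) + 1) ^ 2) := by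
  have h1 : ((n : ℂ) + 1) ≠ 0 := by exact_mod_cast Nat.succ_ne_zero n
  have h2 : (n.factorial : ℂ) ≠ 0 := by exact_mod_cast Nat.factorial_ne_zero n
  simp only [lc, ordinaryHypergeometricCoefficient, ascPochhammer_succ_eval,
    ascPochhammer_eval_one, Nat.factorial_succ, Nat.cast_mul, Nat.cast_add, Nat.cast_one]
  have h3 : (1 : ℂ) + n ≠ 0 := by rwa [add_comm]
  field_simp
  ring

lemma lc_shift (ν : ℂ) (n : ℕ) :
    lc (ν + 1) (n + 1) = - lc ν n * ((ν + 1 + n) * (ν + n + 2) / ((n : ℂ) + 1) ^ 2) := by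
  induction n with
  | zero => rw [lc_succ, lc_zero, lc_zero]; simp; ring
  | succ n ih =>
    have h1 : ((n : ℂ) + 1) ≠ 0 := by exact_mod_cast Nat.succ_ne_zero n
    have h2 : ((n : ℂ) + 1 + 1) ≠ 0 := by exact_mod_cast Nat.succ_ne_zero (n + 1)
    rw [lc_succ, ih, lc_succ]
    push_cast
    field_simp
    ring

lemma lc_contig (ν : ℂ) (n : ℕ) :
    lc (ν + 1) (n + 1) = lc ν (n + 1) - 2 * lc ν n - lh ν (n + 1) := by
  have h1 : ((n : ℂ) + 1) ≠ 0 := by exact_mod_cast Nat.succ_ne_zero n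
  rw [lc_shift, lc_succ, lh]
  field_simp
  ring

lemma lc_bound (ν : ℂ) : ∃ C : ℝ, 0 ≤ C ∧ ∀ n : ℕ, ‖lc ν n‖ * (n + 1) ≤ C := by
  set L := ‖ν * (ν + 1)‖ with hL
  have hL0 : 0 ≤ L := norm_nonneg _
  have key : ∀ n : ℕ, ‖lc ν (n + 1)‖ * (n + 1) ≤
      L * Real.exp L * Real.exp (-(L / (n + 1))) := by
    intro n
    induction n with
    | zero =>
      rw [lc_succ, lc_zero]
      simp only [Nat.cast_zero, zero_add, zero_sub, one_mul, one_pow, div_one, mul_one]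
      rw [mul_assoc, ← Real.exp_add]
      simp only [add_neg_cancel, Real.exp_zero, mul_one, hL]
      rw [neg_mul, norm_neg, add_comm]
    | succ n ih =>
      have hn : (0 : ℝ) < n + 1 := by positivity
      have hn2 : (0 : ℝ) < n + 1 + 1 := by positivity
      have h1 : ((n : ℂ) + 1) ≠ 0 := by exact_mod_cast Nat.succ_ne_zero n
      have h2 : ((n : ℂ) + 1 + 1) ≠ 0 := by exact_mod_cast Nat.succ_ne_zero (n + 1)
      have e1 : lc ν (n + 1 + 1) * (n + 1 + 1) =
          lc ν (n + 1) * (n + 1) * (1 - ν * (ν + 1) / ((n + 1) * (n + 1 + 1))) := by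
        rw [lc_succ ν (n + 1)]
        push_cast
        field_simp
        ring
      have e2 : ‖lc ν (n + 1 + 1)‖ * (n + 1 + 1) =
          ‖lc ν (n + 1)‖ * (n + 1) * ‖1 - ν * (ν + 1) / (((n : ℂ) + 1) * (n + 1 + 1))‖ := by
        have := congrArg norm e1
        rw [norm_mul, norm_mul, norm_mul] at this
        have a1 : ‖(n : ℂ) + 1‖ = n + 1 := by
          rw [← Nat.cast_succ, Complex.norm_natCast]; push_cast; rfl
        have a2 : ‖(n : ℂ) + 1 + 1‖ = n + 1 + 1 := by
          have := Complex.norm_natCast (n + 1 + 1)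
          push_cast at this; exact this
        rw [a1, a2] at this
        exact this
      have e3 : ‖1 - ν * (ν + 1) / (((n : ℂ) + 1) * (n + 1 + 1))‖ ≤
          Real.exp (L / (n + 1) - L / (n + 1 + 1)) := by
        calc _ ≤ ‖(1 : ℂ)‖ + ‖ν * (ν + 1) / (((n : ℂ) + 1) * (n + 1 + 1))‖ := norm_sub_le _ _
          _ = L / (n + 1) - L / (n + 1 + 1) + 1 := by
            rw [norm_div, ← hL]
            have := Complex.norm_natCast ((n + 1) * (n + 1 + 1))
            push_cast at this
            rw [this, norm_one]
            field_simp
            ring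
          _ ≤ _ := Real.add_one_le_exp _
      push_cast
      rw [e2]
      calc _ ≤ L * Real.exp L * Real.exp (-(L / (n + 1))) *
            Real.exp (L / (n + 1) - L / (n + 1 + 1)) := by gcongr
        _ = _ := by
          rw [mul_assoc, ← Real.exp_add]; congr 2; ring
  refine ⟨2 * (L * Real.exp L) + 1, by positivity, ?_⟩
  intro n
  cases n with
  | zero => rw [lc_zero]; simp; positivity
  | succ n =>
    have h := key n
    have h3 : Real.exp (-(L / ((n : ℝ) + 1))) ≤ 1 := by
      rw [Real.exp_le_one_iff, neg_nonpos]; positivity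
    have h4 : L * Real.exp L * Real.exp (-(L / ((n : ℝ) + 1))) ≤ L * Real.exp L * 1 := by gcongr
    have h5 : ‖lc ν (n + 1)‖ * (n : ℝ) ≥ 0 := by positivity
    push_cast
    nlinarith [norm_nonneg (lc ν (n + 1))]

lemma lh_bound (ν : ℂ) : ∃ C : ℝ, 0 ≤ C ∧ ∀ n : ℕ, ‖lh ν n‖ * (n + 1) ≤ C := by
  obtain ⟨C, hC, h⟩ := lc_bound ν
  refine ⟨4 * ‖ν‖ * C, by positivity, ?_⟩
  intro n
  cases n with
  | zero => simp [lh]; positivity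
  | succ n =>
    have a1 : ‖(n : ℂ) + 1‖ = n + 1 := by
      rw [← Nat.cast_succ, Complex.norm_natCast]; push_cast; rfl
    have hn : (0 : ℝ) < n + 1 := by positivity
    have hn' : (0 : ℝ) ≤ n := by positivity
    rw [lh, norm_div, norm_mul, norm_mul, a1]
    have h1 := h n
    have h2 : ‖lc ν n‖ ≤ C := by nlinarith [norm_nonneg (lc ν n)]
    have h3 : ((n : ℝ) + 1 + 1) / (n + 1) ≤ 2 := by rw [div_le_iff₀ hn]; linarith
    push_cast
    calc _ = 2 * ‖ν‖ * ‖lc ν n‖ * (((n : ℝ) + 1 + 1) / (n + 1)) := by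
          simp; ring
      _ ≤ 2 * ‖ν‖ * C * 2 := by gcongr
      _ = _ := by ring

/-- power series with coefficients `a` -/
noncomputable def ps (a : ℕ → ℂ) (z : ℂ) : ℂ := ∑' n, a n * z ^ n

def Bd (a : ℕ → ℂ) : Prop := ∃ C : ℝ, 0 ≤ C ∧ ∀ n : ℕ, ‖a n‖ * (n + 1) ≤ C

lemma Bd.summable {a : ℕ → ℂ} (h : Bd a) {z : ℂ} (hz : ‖z‖ < 1) :
    Summable (fun n => a n * z ^ n) := by
  obtain ⟨C, hC, h⟩ := h
  refine Summable.of_norm_bounded (g := fun n => C * ‖z‖ ^ n)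
    ((summable_geometric_of_lt_one (norm_nonneg _) hz).mul_left C) ?_
  intro n
  rw [norm_mul, norm_pow]
  gcongr
  have := h n
  have h2 : (0 : ℝ) ≤ ‖a n‖ * n := by positivity
  linarith

lemma Bd.summable' {a : ℕ → ℂ} (h : Bd a) {z : ℂ} (hz : ‖z‖ < 1) :
    Summable (fun n : ℕ => ((n : ℂ) + 1) * a (n + 1) * z ^ n) := by
  obtain ⟨C, hC, h⟩ := h
  refine Summable.of_norm_bounded (g := fun n => C * ‖z‖ ^ n)
    ((summable_geometric_of_lt_one (norm_nonneg _) hz).mul_left C) ?_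
  intro n
  have a1 : ‖(n : ℂ) + 1‖ = n + 1 := by
    rw [← Nat.cast_succ, Complex.norm_natCast]; push_cast; rfl
  rw [norm_mul, norm_pow, norm_mul, a1]
  gcongr
  have := h (n + 1)
  push_cast at this
  nlinarith [norm_nonneg (a (n + 1))]

lemma Bd.hasDerivAt {a : ℕ → ℂ} (h : Bd a) {z : ℂ} (hz : ‖z‖ < 1) :
    HasDerivAt (ps a) (∑' n : ℕ, ((n : ℂ) + 1) * a (n + 1) * z ^ n) z := by
  obtain ⟨r, hr1, hr2⟩ := exists_between hz
  have hr0 : 0 ≤ r := (norm_nonneg _).trans hr1.le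
  have h' := h
  obtain ⟨C, hC, hb⟩ := h
  have hd : HasDerivAt (fun z => ∑' n : ℕ, a n * z ^ n) (∑' n : ℕ, a n * (n * z ^ (n - 1))) z := by
    refine hasDerivAt_tsum_of_isPreconnected (g := fun (n : ℕ) (z : ℂ) => a n * z ^ n)
      (g' := fun (n : ℕ) (z : ℂ) => a n * (n * z ^ (n - 1))) (u := fun n : ℕ => C * r ^ (n - 1))
      (t := Metric.ball (0 : ℂ) r) (y₀ := z) ?_ Metric.isOpen_ball
      (convex_ball (0 : ℂ) r).isPreconnected ?_ ?_ ?_ ?_ ?_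
    · refine Summable.mul_left C ?_
      rw [← summable_nat_add_iff 1]
      simpa using summable_geometric_of_lt_one hr0 hr2
    · intro n y _
      exact (hasDerivAt_pow n y).const_mul _
    · intro n y hy
      have hy' : ‖y‖ < r := by simpa using hy
      rw [norm_mul, norm_mul, norm_pow, Complex.norm_natCast, ← mul_assoc]
      gcongr
      have := hb n
      have h2 := norm_nonneg (a n)
      linarith
    · simpa using hr1
    · exact h'.summable hz
    · simpa using hr1
  have e : (∑' n : ℕ, a n * (n * z ^ (n - 1))) = ∑' n : ℕ, ((n : ℂ) + 1) * a (n + 1) * z ^ n := by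
    have hs : Summable (fun n : ℕ => a n * (n * z ^ (n - 1))) := by
      rw [← summable_nat_add_iff 1]
      refine (h'.summable' hz).congr ?_
      intro n
      simp; ring
    rw [hs.tsum_eq_zero_add]
    simp only [Nat.cast_zero, zero_mul, mul_zero, zero_add, Nat.cast_add, Nat.cast_one,
      Nat.add_sub_cancel]
    exact tsum_congr fun n => by ring
  rw [e] at hd
  exact hd

lemma Bd.eq_zero_add {a : ℕ → ℂ} (h : Bd a) {z : ℂ} (hz : ‖z‖ < 1) :
    ps a z = a 0 + z * ∑' n : ℕ, a (n + 1) * z ^ n := by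
  rw [ps, (h.summable hz).tsum_eq_zero_add, ← tsum_mul_left]
  simp only [pow_zero, mul_one]
  congr 1
  exact tsum_congr fun n => by ring

lemma Bd.summable_succ {a : ℕ → ℂ} (h : Bd a) {z : ℂ} (hz : ‖z‖ < 1) :
    Summable (fun n => a (n + 1) * z ^ n) := by
  refine Bd.summable (a := fun n => a (n + 1)) ?_ hz
  obtain ⟨C, hC, h⟩ := h
  refine ⟨C, hC, fun n => ?_⟩
  have := h (n + 1)
  push_cast at this
  nlinarith [norm_nonneg (a (n + 1))]

lemma F_deriv (ν : ℂ) {z : ℂ} (hz : ‖z‖ < 1) :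
    ∃ D, HasDerivAt (ps (lc ν)) D z ∧ z * (1 - z) * D = -((ν + 1) / 2) * ps (lh ν) z := by
  have hb : Bd (lc ν) := lc_bound ν
  have hh : Bd (lh ν) := lh_bound ν
  refine ⟨_, hb.hasDerivAt hz, ?_⟩
  set D := ∑' n : ℕ, ((n : ℂ) + 1) * lc ν (n + 1) * z ^ n with hD
  have s1 : HasSum (fun n : ℕ => ((n : ℂ) + 1) * lc ν (n + 1) * z ^ n) D :=
    (hb.summable' hz).hasSum
  have s2 : HasSum (fun n : ℕ => (n : ℂ) * lc ν n * z ^ n) (z * D) := by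
    rw [← hasSum_nat_add_iff' 1]
    simp only [Finset.range_one, Finset.sum_singleton, Nat.cast_zero, zero_mul, sub_zero]
    convert! s1.mul_left z using 1
    funext n; push_cast; ring
  have s3 := (hh.summable_succ hz).hasSum.mul_left (-((ν + 1) / 2))
  have s4 := s1.sub s2
  have e : (fun n : ℕ => ((n : ℂ) + 1) * lc ν (n + 1) * z ^ n - (n : ℂ) * lc ν n * z ^ n) =
      fun n : ℕ => -((ν + 1) / 2) * (lh ν (n + 1) * z ^ n) := by
    funext n
    have h1 : ((n : ℂ) + 1) ≠ 0 := by exact_mod_cast Nat.succ_ne_zero n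
    rw [lh, lc_succ]
    field_simp
    ring
  rw [e] at s4
  have s5 := s4.unique s3
  rw [hh.eq_zero_add hz]
  simp only [lh, zero_add] at s5 ⊢
  linear_combination z * s5

lemma H_deriv (ν : ℂ) {z : ℂ} (hz : ‖z‖ < 1) :
    HasDerivAt (ps (lh ν)) (2 * ν * ps (lc ν) z) z := by
  have hh : Bd (lh ν) := lh_bound ν
  convert hh.hasDerivAt hz using 1
  rw [ps, ← tsum_mul_left]
  refine tsum_congr fun n => ?_
  have h1 : ((n : ℂ) + 1) ≠ 0 := by exact_mod_cast Nat.succ_ne_zero n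
  rw [lh]
  field_simp

lemma F_contig (ν : ℂ) {z : ℂ} (hz : ‖z‖ < 1) :
    ps (lc (ν + 1)) z = (1 - 2 * z) * ps (lc ν) z - ps (lh ν) z := by
  have hb : Bd (lc ν) := lc_bound ν
  have hb1 : Bd (lc (ν + 1)) := lc_bound (ν + 1)
  have hh : Bd (lh ν) := lh_bound ν
  have s1 := (hb.summable_succ hz).hasSum
  have s2 := (hb.summable hz).hasSum
  have s3 := (hh.summable_succ hz).hasSum
  have s4 := (hb1.summable_succ hz).hasSum
  have s5 := (s1.sub (s2.mul_left 2)).sub s3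
  have e : (fun n : ℕ => lc (ν + 1) (n + 1) * z ^ n) = (fun n : ℕ => lc ν (n + 1) * z ^ n -
      2 * (lc ν n * z ^ n) - lh ν (n + 1) * z ^ n) := by
    funext n
    rw [lc_contig]; ring
  rw [e] at s4
  have s6 := s4.unique s5
  rw [← e] at s6
  have h1 := hb.eq_zero_add hz
  rw [hb1.eq_zero_add hz, s6, hh.eq_zero_add hz, lc_zero]
  rw [lc_zero] at h1
  have h2 : ps (lc ν) z = ∑' n : ℕ, lc ν n * z ^ n := rfl
  rw [← h2]
  simp only [lh] at *
  linear_combination -h1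

lemma legendreP_eq (ν x : ℂ) : legendreP ν x = ps (lc ν) ((1 - x) / 2) := by
  rw [legendreP, ordinaryHypergeometric_eq_tsum, ps]
  simp only [smul_eq_mul]
  rfl

/-- `(1-x²) P_ν'(x) / (ν+1)` -/
noncomputable def lH (ν x : ℂ) : ℂ := ps (lh ν) ((1 - x) / 2)

lemma one_sub_sq_ne {x : ℂ} (h1 : ‖(1 - x) / 2‖ < 1) (h2 : ‖(1 + x) / 2‖ < 1) :
    1 - x ^ 2 ≠ 0 := by
  intro h
  have h3 : (1 - x) * (1 + x) = 0 := by linear_combination h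
  rcases mul_eq_zero.1 h3 with h | h
  · have : x = 1 := by linear_combination -h
    rw [this] at h2; norm_num at h2
  · have : x = -1 := by linear_combination h
    rw [this] at h1; norm_num at h1

lemma P_deriv (ν : ℂ) {x : ℂ} (h1 : ‖(1 - x) / 2‖ < 1) (h2 : ‖(1 + x) / 2‖ < 1) :
    HasDerivAt (legendreP ν) ((ν + 1) * lH ν x / (1 - x ^ 2)) x := by
  obtain ⟨D, hD, e⟩ := F_deriv ν h1
  have hl : HasDerivAt (fun x : ℂ => (1 - x) / 2) (-1 / 2) x :=
    ((hasDerivAt_id x).const_sub 1).div_const 2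
  have := hD.comp x hl
  have e2 : legendreP ν = ps (lc ν) ∘ (fun x : ℂ => (1 - x) / 2) := by
    funext y; exact legendreP_eq ν y
  rw [e2]
  refine this.congr_deriv ?_
  have hw := one_sub_sq_ne h1 h2
  rw [lH, eq_div_iff hw]
  linear_combination (-2) * e

lemma lH_deriv (ν : ℂ) {x : ℂ} (h1 : ‖(1 - x) / 2‖ < 1) :
    HasDerivAt (lH ν) (-ν * legendreP ν x) x := by
  have hl : HasDerivAt (fun x : ℂ => (1 - x) / 2) (-1 / 2) x :=
    ((hasDerivAt_id x).const_sub 1).div_const 2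
  have := (H_deriv ν h1).comp x hl
  have e2 : lH ν = ps (lh ν) ∘ (fun x : ℂ => (1 - x) / 2) := rfl
  rw [e2]
  refine this.congr_deriv ?_
  rw [legendreP_eq]
  ring

lemma P_contig (ν : ℂ) {x : ℂ} (h1 : ‖(1 - x) / 2‖ < 1) :
    legendreP (ν + 1) x = x * legendreP ν x - lH ν x := by
  rw [legendreP_eq, legendreP_eq, F_contig ν h1, lH]
  ring

lemma lH_contig (ν : ℂ) {x : ℂ} (h1 : ‖(1 - x) / 2‖ < 1) (h2 : ‖(1 + x) / 2‖ < 1) :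
    (ν + 2) * lH (ν + 1) x = (ν + 1) * ((1 - x ^ 2) * legendreP ν x + x * lH ν x) := by
  have hw := one_sub_sq_ne h1 h2
  have d1 := P_deriv (ν + 1) h1 h2
  have d2 := ((hasDerivAt_id x).mul (P_deriv ν h1 h2)).sub (lH_deriv ν h1)
  have ev : legendreP (ν + 1) =ᶠ[nhds x] (id * legendreP ν - lH ν) := by
    have ho : IsOpen {x : ℂ | ‖(1 - x) / 2‖ < 1} := isOpen_lt (by fun_prop) (by fun_prop)
    filter_upwards [ho.mem_nhds h1] with y hy
    exact P_contig ν hy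
  have := d1.unique (d2.congr_of_eventuallyEq ev)
  rw [div_eq_iff hw] at this
  simp only [id] at this
  have e : x * ((ν + 1) * lH ν x / (1 - x ^ 2)) * (1 - x ^ 2) = x * ((ν + 1) * lH ν x) := by
    field_simp
  linear_combination this + e

lemma P_contig2 (ν : ℂ) {x : ℂ}
    (h1 : ‖(1 - x) / 2‖ < 1) (h2 : ‖(1 + x) / 2‖ < 1) :
    (ν + 2) * legendreP (ν + 2) x = ((ν + 2) * x ^ 2 - (ν + 1) * (1 - x ^ 2)) * legendreP ν x
      - (2 * ν + 3) * x * lH ν x := by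
  have e : ν + 2 = ν + 1 + 1 := by ring
  have := P_contig (ν + 1) h1
  rw [← e, P_contig ν h1] at this
  linear_combination (ν + 2) * this - lH_contig ν h1 h2

noncomputable def cb0 (n x : ℂ) : ℂ := -(48*n^2+79*n^3)*x + (-16-16*n+152*n^2+222*n^3)*x^3
  + (-80*n-296*n^2-272*n^3)*x^5 + (16+96*n+192*n^2+128*n^3)*x^7
noncomputable def cb1 (n x : ℂ) : ℂ := (48*n^2+63*n^3) + (48+96*n-168*n^2-306*n^3)*x^2
  + (192*n+696*n^2+624*n^3)*x^4 + (-48-288*n-576*n^2-384*n^3)*x^6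
noncomputable def cb2 (n x : ℂ) : ℂ := (-48-144*n-72*n^2+42*n^3)*x
  + (-144*n-504*n^2-432*n^3)*x^3 + (48+288*n+576*n^2+384*n^3)*x^5
noncomputable def cb3 (n x : ℂ) : ℂ := (16+64*n+88*n^2+42*n^3) + (32*n+104*n^2+80*n^3)*x^2
  + (-16-96*n-192*n^2-128*n^3)*x^4

noncomputable def cS (n x u h v k : ℂ) : ℂ :=
  cb0 n x * (u^2*v) + cb1 n x * ((2*u*v*h + u^2*k)/3) + cb2 n x * ((2*u*h*k + v*h^2)/3)
    + cb3 n x * (h^2*k)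

/-- derivative of `cS` along a curve -/
noncomputable def cS' (n x u h v k u' h' v' k' : ℂ) : ℂ :=
  (-(48*n^2+79*n^3) + (-16-16*n+152*n^2+222*n^3)*(3*x^2)
  + (-80*n-296*n^2-272*n^3)*(5*x^4) + (16+96*n+192*n^2+128*n^3)*(7*x^6)) * (u^2*v)
  + cb0 n x * (2*u*u'*v+u^2*v')
  + ((48+96*n-168*n^2-306*n^3)*(2*x)
  + (192*n+696*n^2+624*n^3)*(4*x^3) + (-48-288*n-576*n^2-384*n^3)*(6*x^5))
     * ((2*u*v*h + u^2*k)/3)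
  + cb1 n x * ((2*u'*v*h+2*u*v'*h+2*u*v*h' + 2*u*u'*k+u^2*k')/3)
  + ((-48-144*n-72*n^2+42*n^3)
  + (-144*n-504*n^2-432*n^3)*(3*x^2) + (48+288*n+576*n^2+384*n^3)*(5*x^4))
    * ((2*u*h*k + v*h^2)/3)
  + cb2 n x * ((2*u'*h*k+2*u*h'*k+2*u*h*k' + v'*h^2+2*v*h*h')/3)
  + ((32*n+104*n^2+80*n^3)*(2*x)
  + (-16-96*n-192*n^2-128*n^3)*(4*x^3)) * (h^2*k)
  + cb3 n x * (2*h*h'*k+h^2*k')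

lemma cS_hasDerivAt (n : ℂ) {u h v k : ℂ → ℂ} {u' h' v' k' x : ℂ} (hu : HasDerivAt u u' x)
    (hh : HasDerivAt h h' x) (hv : HasDerivAt v v' x) (hk : HasDerivAt k k' x) :
    HasDerivAt (fun y => cS n y (u y) (h y) (v y) (k y))
      (cS' n x (u x) (h x) (v x) (k x) u' h' v' k') x := by
  have p := fun m : ℕ => hasDerivAt_pow m x
  have i := hasDerivAt_id x
  have d0 : HasDerivAt (cb0 n) _ x :=
    (((i.const_mul (-(48*n^2+79*n^3))).add ((p 3).const_mul (-16-16*n+152*n^2+222*n^3))).add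
    ((p 5).const_mul (-80*n-296*n^2-272*n^3))).add ((p 7).const_mul (16+96*n+192*n^2+128*n^3))
  have d1 : HasDerivAt (cb1 n) _ x :=
    ((((p 2).const_mul (48+96*n-168*n^2-306*n^3)).const_add (48*n^2+63*n^3)).add
    ((p 4).const_mul (192*n+696*n^2+624*n^3))).add ((p 6).const_mul (-48-288*n-576*n^2-384*n^3))
  have d2 : HasDerivAt (cb2 n) _ x :=
    ((i.const_mul (-48-144*n-72*n^2+42*n^3)).add ((p 3).const_mul (-144*n-504*n^2-432*n^3))).add
    ((p 5).const_mul (48+288*n+576*n^2+384*n^3))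
  have d3 : HasDerivAt (cb3 n) _ x :=
    (((p 2).const_mul (32*n+104*n^2+80*n^3)).const_add (16+64*n+88*n^2+42*n^3)).add
    ((p 4).const_mul (-16-96*n-192*n^2-128*n^3))
  have e0 := d0.mul ((hu.pow 2).mul hv)
  have e1 := d1.mul (((((hu.const_mul 2).mul hv).mul hh).add ((hu.pow 2).mul hk)).div_const 3)
  have e2 := d2.mul (((((hu.const_mul 2).mul hh).mul hk).add (hv.mul (hh.pow 2))).div_const 3)
  have e3 := d3.mul ((hh.pow 2).mul hk)
  have e := ((e0.add e1).add e2).add e3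
  refine HasDerivAt.congr_deriv (f := fun y => cS n y (u y) (h y) (v y) (k y)) e ?_
  simp only [cS', Pi.mul_apply, Pi.add_apply, Pi.pow_apply]
  push_cast
  ring

lemma cS_identity (n x u h v k W : ℂ) (hW : (1 - x^2) * W = 1) :
    -n * x * cS n x u h v k +
      (1 - x^2) * cS' n x u h v k (n*h*W) (-(n-1)*u) (n*k*W) (-(n-1)*v)
    = n^4 * (u^2*v) + 64 * (n+1) * (1 - x^2) *
      ((((n+1)*x^2 - n*(1-x^2))*u - (2*n+1)*x*h)^2 * (((n+1)*x^2 - n*(1-x^2))*v - (2*n+1)*x*k)) := by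
  have e : (1 - x^2) * cS' n x u h v k (n*h*W) (-(n-1)*u) (n*k*W) (-(n-1)*v) =
    (1 - x^2) * cS' n x u h v k 0 (-(n-1)*u) 0 (-(n-1)*v)
     + cb0 n x * (2*u*(n*h)*v+u^2*(n*k))
     + cb1 n x * ((2*(n*h)*v*h+2*u*(n*k)*h + 2*u*(n*h)*k)/3)
     + cb2 n x * ((2*(n*h)*h*k+ (n*k)*h^2)/3) := by
    simp only [cS']
    linear_combination (cb0 n x * (2*u*(n*h)*v+u^2*(n*k))
     + cb1 n x * ((2*(n*h)*v*h+2*u*(n*k)*h + 2*u*(n*h)*k)/3)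
     + cb2 n x * ((2*(n*h)*h*k+ (n*k)*h^2)/3)) * hW
  rw [e]
  simp only [cS, cS', cb0, cb1, cb2, cb3]
  ring

lemma Bd.bound {a : ℕ → ℂ} (h : Bd a) {ε : ℝ} (hε : 0 < ε) :
    ∃ C : ℝ, 0 ≤ C ∧ ∀ t : ℝ, 0 < t → t < 1 → ‖ps a (t : ℂ)‖ ≤ C * (1 - t) ^ (-ε) := by
  have h' := h
  obtain ⟨C, hC, hb⟩ := h
  refine ⟨C * (1 + 1 / ε), by positivity, ?_⟩
  intro t ht0 ht1
  have hn : ‖(t : ℂ)‖ < 1 := by rw [Complex.norm_real, Real.norm_eq_abs, abs_of_pos ht0]; exact ht1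
  have hs := (Real.hasSum_pow_div_log_of_abs_lt_one (x := t) (by rwa [abs_of_pos ht0])).mul_left C
  have h1t : 0 < 1 - t := by linarith
  rw [ps, (h'.summable hn).tsum_eq_zero_add]
  have b1 : ‖∑' n : ℕ, a (n + 1) * (t : ℂ) ^ (n + 1)‖ ≤ C * (-Real.log (1 - t)) := by
    refine tsum_of_norm_bounded hs ?_
    intro n
    rw [norm_mul, norm_pow, Complex.norm_real, Real.norm_eq_abs, abs_of_pos ht0]
    have := hb (n + 1)
    push_cast at this
    have hn1 : (0 : ℝ) < n + 1 := by positivity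
    have h3 : ‖a (n + 1)‖ ≤ C / (n + 1) := by
      rw [le_div_iff₀ hn1]
      nlinarith [norm_nonneg (a (n + 1))]
    calc _ ≤ C / (n + 1) * t ^ (n + 1) := by gcongr
      _ = _ := by ring
  have b0 : ‖a 0 * (t : ℂ) ^ 0‖ ≤ C := by
    have := hb 0
    simpa using this
  have b2 : -Real.log (1 - t) ≤ (1 - t) ^ (-ε) / ε := by
    rw [← Real.log_inv, Real.rpow_neg h1t.le, ← Real.inv_rpow h1t.le]
    exact Real.log_le_rpow_div (by positivity) hε
  have b3 : 1 ≤ (1 - t) ^ (-ε) :=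
    Real.one_le_rpow_of_pos_of_le_one_of_nonpos h1t (by linarith) (by linarith)
  calc _ ≤ ‖a 0 * (t : ℂ) ^ 0‖ + ‖∑' n : ℕ, a (n + 1) * (t : ℂ) ^ (n + 1)‖ := norm_add_le _ _
    _ ≤ C * (1 - t) ^ (-ε) + C * ((1 - t) ^ (-ε) / ε) := by
      refine add_le_add (b0.trans ?_) (b1.trans ?_)
      · nlinarith
      · gcongr
    _ = _ := by ring

lemma Bd.boundx {a : ℕ → ℂ} (h : Bd a) {ε : ℝ} (hε : 0 < ε) :
    ∃ C : ℝ, 0 ≤ C ∧ ∀ x : ℝ, x ∈ Set.Ioo (-1 : ℝ) 1 →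
      ‖ps a ((1 - (x : ℂ)) / 2)‖ ≤ C * (1 - x ^ 2) ^ (-ε) := by
  obtain ⟨C, hC, hb⟩ := h.bound hε
  refine ⟨C * (1 / 4) ^ (-ε), by positivity, ?_⟩
  rintro x ⟨hx1, hx2⟩
  have := hb ((1 - x) / 2) (by linarith) (by linarith)
  push_cast at this
  refine this.trans ?_
  have hw : 0 < 1 - x ^ 2 := by nlinarith
  rw [mul_assoc, ← Real.mul_rpow (by norm_num) hw.le]
  refine mul_le_mul_of_nonneg_left ?_ hC
  exact Real.rpow_le_rpow_of_nonpos (by positivity) (by nlinarith) (by linarith)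

lemma P_bound (ν : ℂ) {ε : ℝ} (hε : 0 < ε) : ∃ C : ℝ, 0 ≤ C ∧ ∀ x : ℝ, x ∈ Set.Ioo (-1 : ℝ) 1 →
    ‖legendreP ν x‖ ≤ C * (1 - x ^ 2) ^ (-ε) ∧ ‖legendreP ν (-x)‖ ≤ C * (1 - x ^ 2) ^ (-ε) ∧
    ‖lH ν x‖ ≤ C * (1 - x ^ 2) ^ (-ε) ∧ ‖-lH ν (-x)‖ ≤ C * (1 - x ^ 2) ^ (-ε) := by
  obtain ⟨C1, hC1, h1⟩ := Bd.boundx (lc_bound ν) hε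
  obtain ⟨C2, hC2, h2⟩ := Bd.boundx (lh_bound ν) hε
  refine ⟨C1 + C2, by positivity, ?_⟩
  intro x hx
  have hx' : -x ∈ Set.Ioo (-1 : ℝ) 1 := ⟨by linarith [hx.2], by linarith [hx.1]⟩
  have hw : 0 < 1 - x ^ 2 := by nlinarith [hx.1, hx.2]
  have a1 := h1 x hx
  have a2 := h1 (-x) hx'
  have a3 := h2 x hx
  have a4 := h2 (-x) hx'
  rw [neg_sq] at a2 a4
  push_cast at a2 a4
  have hp : 0 ≤ (1 - x ^ 2) ^ (-ε) := by positivity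
  have k1 : C1 * (1 - x ^ 2) ^ (-ε) ≤ (C1 + C2) * (1 - x ^ 2) ^ (-ε) := by gcongr; linarith
  have k2 : C2 * (1 - x ^ 2) ^ (-ε) ≤ (C1 + C2) * (1 - x ^ 2) ^ (-ε) := by gcongr; linarith
  rw [legendreP_eq, legendreP_eq, norm_neg, lH, lH]
  exact ⟨a1.trans k1, a2.trans k1, a3.trans k2, a4.trans k2⟩

lemma w_integrable {b : ℝ} (hb : -1 < b) :
    IntegrableOn (fun x : ℝ => (1 - x ^ 2) ^ b) (Set.Ioo (-1) 1) := by
  set c := min b 0 with hc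
  have hc1 : -1 < c := lt_min hb (by norm_num)
  have hc0 : c ≤ 0 := min_le_right _ _
  have hcb : c ≤ b := min_le_left _ _
  have i1 : IntegrableOn (fun x : ℝ => (1 - x) ^ c) (Set.Ioo (-1) 1) := by
    rw [← intervalIntegrable_iff_integrableOn_Ioo_of_le (by norm_num)]
    have := (intervalIntegrable_rpow' (a := 2) (b := 0) hc1).comp_sub_left 1
    norm_num at this
    exact this
  have i2 : IntegrableOn (fun x : ℝ => (1 + x) ^ c) (Set.Ioo (-1) 1) := by
    rw [← intervalIntegrable_iff_integrableOn_Ioo_of_le (by norm_num)]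
    have := (intervalIntegrable_rpow' (a := 0) (b := 2) hc1).comp_add_left 1
    norm_num at this
    exact this
  refine Integrable.mono' (i1.add i2) ?_ ?_
  · refine ContinuousOn.aestronglyMeasurable ?_ measurableSet_Ioo
    refine ContinuousOn.rpow_const (by fun_prop) ?_
    intro x hx
    left
    have : 0 < 1 - x ^ 2 := by nlinarith [hx.1, hx.2]
    exact this.ne'
  · refine (ae_restrict_iff' measurableSet_Ioo).2 (Filter.Eventually.of_forall ?_)
    intro x hx
    have h1 : 0 < 1 - x := by linarith [hx.2]
    have h2 : 0 < 1 + x := by linarith [hx.1]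
    have hw : 0 < 1 - x ^ 2 := by nlinarith [hx.1, hx.2]
    rw [Real.norm_eq_abs, abs_of_nonneg (by positivity)]
    have e : (1 - x ^ 2) ^ c = (1 - x) ^ c * (1 + x) ^ c := by
      rw [← Real.mul_rpow h1.le h2.le]; congr 1; ring
    have p1 : 0 ≤ (1 - x) ^ c := by positivity
    have p2 : 0 ≤ (1 + x) ^ c := by positivity
    refine (Real.rpow_le_rpow_of_exponent_ge hw (by nlinarith) hcb).trans ?_
    rw [e, Pi.add_apply]
    rcases le_total 0 x with h | h
    · have := Real.rpow_le_one_of_one_le_of_nonpos (x := 1 + x) (by linarith) hc0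
      nlinarith
    · have := Real.rpow_le_one_of_one_le_of_nonpos (x := 1 - x) (by linarith) hc0
      nlinarith

lemma ioo_norm {x : ℝ} (hx : x ∈ Set.Ioo (-1 : ℝ) 1) :
    ‖(1 - (x : ℂ)) / 2‖ < 1 ∧ ‖(1 + (x : ℂ)) / 2‖ < 1 := by
  have e1 : (1 - (x : ℂ)) / 2 = (((1 - x) / 2 : ℝ) : ℂ) := by push_cast; rfl
  have e2 : (1 + (x : ℂ)) / 2 = (((1 + x) / 2 : ℝ) : ℂ) := by push_cast; rfl
  rw [e1, e2, Complex.norm_real, Complex.norm_real, Real.norm_eq_abs, Real.norm_eq_abs, abs_lt,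
    abs_lt]
  obtain ⟨h1, h2⟩ := hx
  refine ⟨⟨?_, ?_⟩, ?_, ?_⟩ <;> linarith

lemma w_slit {x : ℝ} (hx : x ∈ Set.Ioo (-1 : ℝ) 1) : 1 - (x : ℂ) ^ 2 ∈ Complex.slitPlane := by
  have hw : 0 < 1 - x ^ 2 := by nlinarith [hx.1, hx.2]
  have : 1 - (x : ℂ) ^ 2 = ((1 - x ^ 2 : ℝ) : ℂ) := by push_cast; rfl
  rw [this]
  exact Complex.ofReal_mem_slitPlane.2 hw

lemma w_norm {x : ℝ} (hx : x ∈ Set.Ioo (-1 : ℝ) 1) (s : ℂ) :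
    ‖(1 - (x : ℂ) ^ 2) ^ s‖ = (1 - x ^ 2) ^ s.re := by
  have hw : 0 < 1 - x ^ 2 := by nlinarith [hx.1, hx.2]
  have : 1 - (x : ℂ) ^ 2 = ((1 - x ^ 2 : ℝ) : ℂ) := by push_cast; rfl
  rw [this, Complex.norm_cpow_eq_rpow_re_of_pos hw]

lemma w_deriv {x : ℝ} (hx : x ∈ Set.Ioo (-1 : ℝ) 1) (s : ℂ) :
    HasDerivAt (fun y : ℂ => (1 - y ^ 2) ^ s) (s * (1 - (x : ℂ) ^ 2) ^ (s - 1) * (-(2 * x))) x := by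
  have := ((hasDerivAt_pow 2 (x : ℂ)).const_sub 1).cpow_const (c := s) (w_slit hx)
  refine this.congr_deriv ?_
  push_cast
  ring

lemma Pneg_deriv (ν : ℂ) {x : ℂ} (h1 : ‖(1 - x) / 2‖ < 1) (h2 : ‖(1 + x) / 2‖ < 1) :
    HasDerivAt (fun y => legendreP ν (-y)) ((ν + 1) * (-lH ν (-x)) / (1 - x ^ 2)) x := by
  have h := P_deriv ν (x := -x) (by simpa using h2) (by simpa [sub_eq_add_neg] using h1)
  have := h.comp x (hasDerivAt_neg x)
  refine HasDerivAt.congr_deriv (f := fun y => legendreP ν (-y)) this ?_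
  rw [neg_sq]; ring

lemma lHneg_deriv (ν : ℂ) {x : ℂ} (h2 : ‖(1 + x) / 2‖ < 1) :
    HasDerivAt (fun y => -lH ν (-y)) (-ν * legendreP ν (-x)) x := by
  have h := lH_deriv ν (x := -x) (by simpa using h2)
  have := (h.comp x (hasDerivAt_neg x)).neg
  refine HasDerivAt.congr_deriv (f := fun y => -lH ν (-y)) this ?_
  ring

lemma J_integrable (ν s : ℂ) (hs : -1 < s.re) :
    IntervalIntegrable (fun x : ℝ => (legendreP ν (x : ℂ)) ^ 2 * legendreP ν (-(x : ℂ)) *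
        ((1 - (x:ℂ) ^ 2) ^ s)) volume (-1) 1 := by
  rw [intervalIntegrable_iff_integrableOn_Ioo_of_le (by norm_num)]
  obtain ⟨C, hC, hb⟩ := P_bound ν (ε := (s.re + 1) / 6) (by linarith)
  have hi := (w_integrable (b := (s.re + 1) / 2 - 1) (by linarith)).const_mul (C ^ 3)
  refine Integrable.mono' hi ?_ ?_
  · refine ContinuousOn.aestronglyMeasurable ?_ measurableSet_Ioo
    intro x hx
    obtain ⟨h1, h2⟩ := ioo_norm hx
    have d1 := (P_deriv ν h1 h2).comp_ofReal.continuousAt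
    have d2 := (Pneg_deriv ν h1 h2).comp_ofReal.continuousAt
    have d3 := (w_deriv hx s).comp_ofReal.continuousAt
    exact (((d1.pow 2).mul d2).mul d3).continuousWithinAt
  · refine (ae_restrict_iff' measurableSet_Ioo).2 (Filter.Eventually.of_forall ?_)
    intro x hx
    obtain ⟨b1, b2, -, -⟩ := hb x hx
    have hw : 0 < 1 - x ^ 2 := by nlinarith [hx.1, hx.2]
    rw [norm_mul, norm_mul, norm_pow, w_norm hx]
    set M := (1 - x ^ 2) ^ (-((s.re + 1) / 6)) with hM
    have hM0 : 0 ≤ M := by positivity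
    calc _ ≤ (C * M) ^ 2 * (C * M) * (1 - x ^ 2) ^ s.re := by gcongr
      _ = C ^ 3 * (M * M * M * (1 - x ^ 2) ^ s.re) := by ring
      _ = _ := by
        rw [hM, ← Real.rpow_add hw, ← Real.rpow_add hw, ← Real.rpow_add hw]
        congr 2
        ring

lemma cS_bound (n : ℂ) : ∃ K : ℝ, 0 ≤ K ∧ ∀ x : ℝ, x ∈ Set.Ioo (-1 : ℝ) 1 →
    ∀ (u h v k : ℂ) (M : ℝ), ‖u‖ ≤ M → ‖h‖ ≤ M → ‖v‖ ≤ M → ‖k‖ ≤ M →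
      ‖cS n x u h v k‖ ≤ K * M ^ 3 := by
  have hc : IsCompact (Set.Icc (-1 : ℝ) 1) := isCompact_Icc
  obtain ⟨K0, h0⟩ := hc.exists_bound_of_continuousOn (f := fun x : ℝ => cb0 n x)
    (by unfold cb0; fun_prop)
  obtain ⟨K1, h1⟩ := hc.exists_bound_of_continuousOn (f := fun x : ℝ => cb1 n x)
    (by unfold cb1; fun_prop)
  obtain ⟨K2, h2⟩ := hc.exists_bound_of_continuousOn (f := fun x : ℝ => cb2 n x)
    (by unfold cb2; fun_prop)
  obtain ⟨K3, h3⟩ := hc.exists_bound_of_continuousOn (f := fun x : ℝ => cb3 n x)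
    (by unfold cb3; fun_prop)
  have z : (0 : ℝ) ∈ Set.Icc (-1 : ℝ) 1 := by constructor <;> norm_num
  have p0 := (norm_nonneg _).trans (h0 0 z)
  have p1 := (norm_nonneg _).trans (h1 0 z)
  have p2 := (norm_nonneg _).trans (h2 0 z)
  have p3 := (norm_nonneg _).trans (h3 0 z)
  refine ⟨K0 + K1 + K2 + K3, by positivity, ?_⟩
  intro x hx u h v k M hu hh hv hk
  have hx' : x ∈ Set.Icc (-1 : ℝ) 1 := ⟨hx.1.le, hx.2.le⟩
  have hM : 0 ≤ M := (norm_nonneg _).trans hu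
  have t3 : ∀ a b c : ℂ, ‖a‖ ≤ M → ‖b‖ ≤ M → ‖c‖ ≤ M → ‖a * b * c‖ ≤ M ^ 3 := by
    intro a b c ha hb hc
    rw [norm_mul, norm_mul]
    calc _ ≤ M * M * M := by gcongr
      _ = _ := by ring
  have t6 : ∀ a b : ℂ, ‖a‖ ≤ M ^ 3 → ‖b‖ ≤ M ^ 3 → ‖(2 * a + b) / 3‖ ≤ M ^ 3 := by
    intro a b ha hb
    have := norm_add_le (2 * a) b
    rw [norm_mul] at this
    rw [norm_div]
    norm_num at this ⊢
    linarith
  have q0 := t3 u u v hu hu hv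
  have q1 := t6 _ _ (t3 u v h hu hv hh) (t3 u u k hu hu hk)
  have q2 := t6 _ _ (t3 u h k hu hh hk) (t3 v h h hv hh hh)
  have q3 := t3 h h k hh hh hk
  have e : cS n x u h v k = cb0 n x * (u * u * v) + cb1 n x * ((2 * (u * v * h) + u * u * k) / 3)
      + cb2 n x * ((2 * (u * h * k) + v * h * h) / 3) + cb3 n x * (h * h * k) := by
    rw [cS]; ring
  rw [e]
  refine (norm_add₄_le).trans ?_
  simp only [norm_mul (cb0 n x), norm_mul (cb1 n x), norm_mul (cb2 n x), norm_mul (cb3 n x)]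
  calc _ ≤ K0 * M ^ 3 + K1 * M ^ 3 + K2 * M ^ 3 + K3 * M ^ 3 := by
        gcongr
        · exact h0 x hx'
        · exact h1 x hx'
        · exact h2 x hx'
        · exact h3 x hx'
    _ = _ := by ring

noncomputable def cQ (ν y : ℂ) : ℂ := (1 - y ^ 2) ^ ((ν + 1) / 2) *
  cS (ν + 1) y (legendreP ν y) (lH ν y) (legendreP ν (-y)) (-lH ν (-y))

lemma cQ_bound (ν : ℂ) (hν : -1 < ν.re) : ∃ K : ℝ, ∀ x : ℝ, x ∈ Set.Ioo (-1 : ℝ) 1 →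
    ‖cQ ν x‖ ≤ K * (1 - x ^ 2) ^ ((ν.re + 1) / 4) := by
  obtain ⟨C, hC, hb⟩ := P_bound ν (ε := (ν.re + 1) / 12) (by linarith)
  obtain ⟨K, hK, hS⟩ := cS_bound (ν + 1)
  refine ⟨K * C ^ 3, ?_⟩
  intro x hx
  have hw : 0 < 1 - x ^ 2 := by nlinarith [hx.1, hx.2]
  obtain ⟨b1, b2, b3, b4⟩ := hb x hx
  have := hS x hx _ _ _ _ _ b1 b3 b2 b4
  rw [cQ, norm_mul, w_norm hx]
  have er : ((ν + 1) / 2).re = (ν.re + 1) / 2 := by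
    rw [show (ν + 1) / 2 = (ν + 1) / ((2 : ℝ) : ℂ) by norm_num, Complex.div_ofReal_re]; simp
  rw [er]
  set M := (1 - x ^ 2) ^ (-((ν.re + 1) / 12)) with hM
  calc _ ≤ (1 - x ^ 2) ^ ((ν.re + 1) / 2) * (K * (C * M) ^ 3) := by gcongr
    _ = K * C ^ 3 * (M * M * M * (1 - x ^ 2) ^ ((ν.re + 1) / 2)) := by ring
    _ = _ := by
      rw [hM, ← Real.rpow_add hw, ← Real.rpow_add hw, ← Real.rpow_add hw]
      congr 2
      ring

lemma cQ_tendsto (ν : ℂ) (hν : -1 < ν.re) (c : ℝ) (hc : c ^ 2 = 1) (l : Filter ℝ)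
    (hl : l ≤ nhds c) (hl2 : Set.Ioo (-1 : ℝ) 1 ∈ l) :
    Filter.Tendsto (fun x : ℝ => cQ ν x) l (nhds 0) := by
  obtain ⟨K, hK⟩ := cQ_bound ν hν
  refine squeeze_zero_norm' (a := fun x : ℝ => K * (1 - x ^ 2) ^ ((ν.re + 1) / 4)) ?_ ?_
  · filter_upwards [hl2] with x hx using hK x hx
  · have hp : 0 < (ν.re + 1) / 4 := by linarith
    have hcont : Continuous (fun x : ℝ => K * (1 - x ^ 2) ^ ((ν.re + 1) / 4)) := by
      refine continuous_const.mul (Continuous.rpow_const (by fun_prop) ?_)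
      intro x; right; exact hp.le
    have := (hcont.tendsto c).mono_left hl
    simpa [hc, Real.zero_rpow hp.ne'] using this

lemma cQ_deriv (ν : ℂ) {x : ℝ} (hx : x ∈ Set.Ioo (-1 : ℝ) 1) :
    HasDerivAt (fun x : ℝ => cQ ν x)
      ((ν + 1) ^ 4 * ((legendreP ν (x : ℂ)) ^ 2 * legendreP ν (-(x : ℂ)) *
        ((1 - (x:ℂ) ^ 2) ^ ((ν - 1)/2))) +
       64 * (ν + 2) ^ 4 * ((legendreP (ν + 2) (x : ℂ)) ^ 2 * legendreP (ν + 2) (-(x : ℂ)) *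
          ((1 - (x:ℂ) ^ 2) ^ ((ν + 1)/2)))) x := by
  obtain ⟨h1, h2⟩ := ioo_norm hx
  have hw := one_sub_sq_ne h1 h2
  have dS := cS_hasDerivAt (ν + 1) (P_deriv ν h1 h2) (lH_deriv ν h1) (Pneg_deriv ν h1 h2)
    (lHneg_deriv ν h2)
  have dQ := ((w_deriv hx ((ν + 1) / 2)).mul dS).comp_ofReal
  refine HasDerivAt.congr_deriv (f := fun x : ℝ => cQ ν x) dQ ?_
  have es : (ν + 1) / 2 - 1 = (ν - 1) / 2 := by ring
  have ew : (1 - (x : ℂ) ^ 2) ^ ((ν + 1) / 2) =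
      (1 - (x : ℂ) ^ 2) ^ ((ν - 1) / 2) * (1 - (x : ℂ) ^ 2) := by
    rw [← es, Complex.cpow_sub _ _ hw, Complex.cpow_one, div_mul_cancel₀ _ hw]
  rw [es, ew]
  have c1 := P_contig2 ν h1 h2
  have c2 := P_contig2 ν (x := -(x : ℂ)) (by simpa using h2) (by simpa [sub_eq_add_neg] using h1)
  have key := cS_identity (ν + 1) x (legendreP ν x) (lH ν x) (legendreP ν (-x)) (-lH ν (-x))
    (1 - (x : ℂ) ^ 2)⁻¹ (mul_inv_cancel₀ hw)
  simp only [div_eq_mul_inv _ (1 - (x : ℂ) ^ 2)]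
  have a1 : ν + 1 - 1 = ν := by ring
  rw [a1] at key
  have e1 : ((ν + 1 + 1) * (x : ℂ) ^ 2 - (ν + 1) * (1 - (x : ℂ) ^ 2)) * legendreP ν x
      - (2 * (ν + 1) + 1) * x * lH ν x = (ν + 2) * legendreP (ν + 2) x := by
    rw [c1]; ring
  have e2 : ((ν + 1 + 1) * (x : ℂ) ^ 2 - (ν + 1) * (1 - (x : ℂ) ^ 2)) * legendreP ν (-x)
      - (2 * (ν + 1) + 1) * x * (-lH ν (-x)) = (ν + 2) * legendreP (ν + 2) (-x) := by
    rw [c2]; ring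
  rw [e1, e2] at key
  linear_combination (1 - (x : ℂ) ^ 2) ^ ((ν - 1) / 2) * key

theorem stmt10 (ν : ℂ) (hν : -1 < ν.re) :
    (∫ x in (-1:ℝ)..1, (legendreP ν (x : ℂ)) ^ 2 * legendreP ν (-(x : ℂ)) *
        ((1 - (x:ℂ) ^ 2) ^ ((ν - 1)/2)))
      = -(64 * (ν + 2) ^ 4 / (ν + 1) ^ 4) *
        ∫ x in (-1:ℝ)..1, (legendreP (ν + 2) (x : ℂ)) ^ 2 * legendreP (ν + 2) (-(x : ℂ)) *
          ((1 - (x:ℂ) ^ 2) ^ ((ν + 1)/2)) := by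
  have n1 : ν + 1 ≠ 0 := by
    intro h
    have := congrArg Complex.re h
    simp at this; linarith
  have er1 : ((ν - 1) / 2).re = (ν.re - 1) / 2 := by
    rw [show (ν - 1) / 2 = (ν - 1) / ((2 : ℝ) : ℂ) by norm_num, Complex.div_ofReal_re]; simp
  have er2 : ((ν + 1) / 2).re = (ν.re + 1) / 2 := by
    rw [show (ν + 1) / 2 = (ν + 1) / ((2 : ℝ) : ℂ) by norm_num, Complex.div_ofReal_re]; simp
  have i1 := (J_integrable ν ((ν - 1) / 2) (by rw [er1]; linarith)).const_mul ((ν + 1) ^ 4)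
  have i2 := (J_integrable (ν + 2) ((ν + 1) / 2) (by rw [er2]; linarith)).const_mul
    (64 * (ν + 2) ^ 4)
  have h := integral_eq_sub_of_hasDerivAt_of_tendsto (a := -1) (b := 1) (by norm_num)
    (fun x hx => cQ_deriv ν hx) (i1.add i2)
    (cQ_tendsto ν hν (-1) (by norm_num) _ nhdsWithin_le_nhds (Ioo_mem_nhdsGT (by norm_num)))
    (cQ_tendsto ν hν 1 (by norm_num) _ nhdsWithin_le_nhds (Ioo_mem_nhdsLT (by norm_num)))
  rw [integral_add i1 i2, intervalIntegral.integral_const_mul, intervalIntegral.integral_const_mul, sub_zero] at h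
  have n4 : (ν + 1) ^ 4 ≠ 0 := pow_ne_zero _ n1
  rw [← neg_div, div_mul_eq_mul_div, eq_div_iff n4]
  linear_combination h
end
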